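/- Let k ≥ 3 and r ∈ ℕ, let δ₀ = (2r)^(−2^(k+1)) and ε* = (2r)^(−2^(k+7))/k. There exists ψ₀ > 0 depending only on r and k such that for every 0 < ψ ≤ ψ₀ there exists n₀ such that the following holds for all n ≥ n₀: for every r-edge-coloured K_n^(k) (call it H), there exists a vertex set U* with |U*| ≤ 3n/4 such that for every B* ⊆ V(H) \ U* with |B*| = ⌈4ε*n⌉, the induced subgraph H[B* ∪ U*] can be covered by at most 2^18·r·δ₀^(−5) + 1 vertex-disjoint monochromatic tight cycles together with at most ψn isolated vertices. -/

import Mathlib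

/-- A vertex set `C` forms a monochromatic tight cycle in the `χ`-edge-coloured complete
`k`-graph on `Fin n`: either `C` is degenerate (at most `k` vertices), or the vertices of `C`
can be cyclically ordered so that every `k` consecutive vertices form an edge, all of these
edges having the same colour. -/
def MonoTightCycle {n : ℕ} {α : Type*} (k : ℕ) (χ : Finset (Fin n) → α)
    (C : Finset (Fin n)) : Prop :=
  C.card ≤ k ∨
  ∃ (g : ℕ → Fin n) (c : α),
    (∀ i, g (i + C.card) = g i) ∧
    Set.InjOn g (Set.Iio C.card) ∧
    (Finset.range C.card).image g = C ∧
    ∀ i, χ ((Finset.range k).image (fun j => g (i + j))) = c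

section AlmostCover

open Finset

theorem card_apply_eq_apply_mul_le {ι α : Type*} [Fintype ι] [DecidableEq ι] [Fintype α]
    [DecidableEq α] {i j : ι} (hij : i ≠ j) :
    #{x : ι → α | x i = x j} * Fintype.card α ≤ Fintype.card (ι → α) := by
  rw [← card_univ (α := α), ← card_product, ← card_univ (α := ι → α)]
  refine card_le_card_of_injOn (fun p => Function.update p.1 i p.2) (by simp) ?_
  rintro ⟨x, a⟩ hx ⟨y, b⟩ hy h
  simp only [coe_product, coe_filter, mem_univ, true_and, coe_univ, Set.mem_prod,
    Set.mem_ofPred_eq, Set.mem_univ, and_true] at hx hy h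
  have h1 : ∀ l, l ≠ i → x l = y l := fun l hl => by
    simpa [Function.update_of_ne hl] using congrFun h l
  have h2 : a = b := by simpa using congrFun h i
  refine Prod.ext (funext fun l => ?_) h2
  by_cases hl : l = i
  · subst hl
    show x l = y l
    rw [hx, hy]
    exact h1 _ hij.symm
  · exact h1 l hl

theorem card_not_injective_mul_le {ι α : Type*} [Fintype ι] [DecidableEq ι] [Fintype α]
    [DecidableEq α] :
    #{x : ι → α | ¬ Function.Injective x} * Fintype.card α
      ≤ Fintype.card ι ^ 2 * Fintype.card (ι → α) := by
  have hsub : ({x : ι → α | ¬ Function.Injective x} : Finset _) ⊆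
      (univ.offDiag : Finset (ι × ι)).biUnion fun p => {x : ι → α | x p.1 = x p.2} := by
    intro x hx
    simp only [mem_filter, mem_univ, true_and, Function.Injective, not_forall] at hx
    obtain ⟨a, b, h, hab⟩ := hx
    simp only [mem_biUnion, mem_offDiag, mem_univ, true_and, mem_filter, Prod.exists]
    exact ⟨a, b, hab, h⟩
  calc _ ≤ (∑ p ∈ (univ.offDiag : Finset (ι × ι)), #{x : ι → α | x p.1 = x p.2})
        * Fintype.card α := Nat.mul_le_mul_right _ ((card_le_card hsub).trans card_biUnion_le)
    _ = ∑ p ∈ (univ.offDiag : Finset (ι × ι)), #{x : ι → α | x p.1 = x p.2}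
        * Fintype.card α := sum_mul _ _ _
    _ ≤ ∑ p ∈ (univ.offDiag : Finset (ι × ι)), Fintype.card (ι → α) := by
        refine sum_le_sum fun p hp => ?_
        exact card_apply_eq_apply_mul_le (by simpa using hp)
    _ ≤ _ := by
        rw [sum_const, smul_eq_mul]
        refine Nat.mul_le_mul_right _ ?_
        rw [offDiag_card, card_univ, sq]
        exact Nat.sub_le _ _

theorem card_meets_mul_le {ι α : Type*} [Fintype ι] [DecidableEq ι] [Fintype α]
    [DecidableEq α] (Q : Finset α) :
    #{x : ι → α | ∃ i, x i ∈ Q} * Fintype.card α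
      ≤ Fintype.card ι * (#Q * Fintype.card (ι → α)) := by
  have hsub : ({x : ι → α | ∃ i, x i ∈ Q} : Finset _) ⊆
      (univ : Finset ι).biUnion fun i => {x : ι → α | x i ∈ Q} := by
    intro x hx
    simpa using hx
  have key : ∀ i : ι, #{x : ι → α | x i ∈ Q} * Fintype.card α
      ≤ #Q * Fintype.card (ι → α) := by
    intro i
    rw [← card_univ (α := α), ← card_product, ← card_univ (α := ι → α), ← card_product]
    refine card_le_card_of_injOn (fun p => (p.1 i, Function.update p.1 i p.2)) ?_ ?_
    · rintro ⟨x, a⟩ hx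
      simpa using hx
    rintro ⟨x, a⟩ hx ⟨y, b⟩ hy h
    simp only [Prod.mk.injEq] at h
    obtain ⟨h0, h⟩ := h
    have h2 : a = b := by simpa using congrFun h i
    refine Prod.ext (funext fun l => ?_) h2
    by_cases hl : l = i
    · subst hl; exact h0
    · simpa [Function.update_of_ne hl] using congrFun h l
  calc _ ≤ (∑ i : ι, #{x : ι → α | x i ∈ Q}) * Fintype.card α :=
        Nat.mul_le_mul_right _ ((card_le_card hsub).trans card_biUnion_le)
    _ = ∑ i : ι, #{x : ι → α | x i ∈ Q} * Fintype.card α := sum_mul _ _ _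
    _ ≤ ∑ i : ι, #Q * Fintype.card (ι → α) := sum_le_sum fun i _ => key i
    _ = _ := by simp

/-- A dense `k`-partite pattern contains a complete `k`-partite pattern with parts of size `m`. -/
theorem exists_blowup (m : ℕ) : ∀ (k : ℕ) (κ : ℝ), 0 < κ → ∃ N₁ : ℕ,
    ∀ (α : Type) [Fintype α] [DecidableEq α], N₁ ≤ Fintype.card α →
    ∀ E : Finset (Fin k → α), κ * (Fintype.card α : ℝ) ^ k ≤ #E →
    ∃ t : Fin k → Fin m → α, (∀ j, Function.Injective (t j)) ∧
      ∀ φ : Fin k → Fin m, (fun j => t j (φ j)) ∈ E := by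
  intro k
  induction k with
  | zero =>
    intro κ hκ
    refine ⟨0, fun α _ _ _ E hE => ⟨fun j => j.elim0, fun j => j.elim0, fun φ => ?_⟩⟩
    have : 0 < #E := by
      have : (0 : ℝ) < #E := lt_of_lt_of_le (by simpa using hκ) hE
      exact_mod_cast this
    obtain ⟨e, he⟩ := card_pos.1 this
    convert he
  | succ k ih =>
    intro κ hκ
    obtain ⟨N₁, hN₁⟩ := ih (κ ^ m / 2) (by positivity)
    obtain ⟨N₂, hN₂⟩ := exists_nat_ge ((m : ℝ) ^ 2 * 2 / κ ^ m)
    refine ⟨max N₁ (N₂ + 1), fun α _ _ hN E hE => ?_⟩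
    have hNpos : 0 < Fintype.card α := by
      have := le_max_right N₁ (N₂ + 1); omega
    set N : ℝ := ((Fintype.card α : ℕ) : ℝ) with hNdef
    have hNR : 0 < N := by
      rw [hNdef]
      exact_mod_cast hNpos
    have hN2 : (m : ℝ) ^ 2 * 2 < κ ^ m * N := by
      have h1 : N₂ < Fintype.card α := by
        have := le_max_right N₁ (N₂ + 1)
        omega
      have h2 : (N₂ : ℝ) < N := by
        rw [hNdef]
        exact_mod_cast h1
      have := (div_lt_iff₀ (by positivity)).1 (hN₂.trans_lt h2)
      linarith
    let S : (Fin k → α) → Finset α := fun g => {x | Fin.cons x g ∈ E}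
    let Lx : (Fin m → α) → Finset (Fin k → α) := fun x => {g | ∀ a, Fin.cons (x a) g ∈ E}
    have hSE : ∑ g, (#(S g) : ℝ) = #E := by
      rw [← Nat.cast_sum]
      congr 1
      have : #E = #((univ : Finset (Σ _ : (Fin k → α), α)).filter
          fun p => (Fin.cons p.2 p.1 : Fin (k + 1) → α) ∈ E) := by
        symm
        refine card_bij (fun p _ => Fin.cons p.2 p.1) (by simp) ?_ ?_
        · rintro ⟨g, x⟩ _ ⟨g', x'⟩ _ h
          have h1 := Fin.cons_injective2 h
          obtain ⟨h2, h3⟩ := h1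
          simp only at h2 h3
          subst h2 h3
          rfl
        · intro e he
          exact ⟨⟨Fin.tail e, e 0⟩, by simpa [Fin.cons_self_tail] using he,
            Fin.cons_self_tail e⟩
      rw [this, ← univ_sigma_univ, card_filter, sum_sigma]
      exact sum_congr rfl fun g _ => by simp only [S, card_filter]
    have hdouble : ∑ x, (#(Lx x) : ℝ) = ∑ g, (#(S g) : ℝ) ^ m := by
      have : ∀ g, (#(S g)) ^ m = #{x : Fin m → α | ∀ a, Fin.cons (x a) g ∈ E} := by
        intro g
        rw [← Fintype.card_piFinset_const (S g) m]
        congr 1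
        ext x
        simp [S, Fintype.mem_piFinset]
      simp_rw [← Nat.cast_pow, this, ← Nat.cast_sum]
      congr 1
      simp only [Lx, card_filter]
      exact sum_comm
    have hcardk : (#(univ : Finset (Fin k → α)) : ℝ) = N ^ k := by simp [hNdef]
    have hjensen : N ^ k * (κ * N) ^ m ≤ ∑ g, (#(S g) : ℝ) ^ m := by
      rcases Nat.eq_zero_or_pos m with rfl | hm
      · simp [hNdef]
      obtain ⟨m', rfl⟩ := Nat.exists_eq_succ_of_ne_zero hm.ne'
      have h := pow_sum_div_card_le_sum_pow (s := (univ : Finset (Fin k → α)))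
        (f := fun g => (#(S g) : ℝ)) (fun _ _ => by positivity) m'
      rw [hSE, hcardk] at h
      refine le_trans ?_ h
      rw [le_div_iff₀ (by positivity)]
      calc N ^ k * (κ * N) ^ (m' + 1) * (N ^ k) ^ m' = (κ * N ^ (k + 1)) ^ (m' + 1) := by ring
        _ ≤ _ := by gcongr
    by_contra hcon
    have hbad : ∀ x : Fin m → α, Function.Injective x → (#(Lx x) : ℝ) < κ ^ m / 2 * N ^ k := by
      intro x hx
      by_contra hlt
      obtain ⟨t, ht, htE⟩ := hN₁ α ((le_max_left _ _).trans hN) (Lx x) (not_lt.1 hlt)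
      refine hcon ⟨Fin.cons x t, ?_, fun φ => ?_⟩
      · intro j
        refine Fin.cases ?_ (fun j => ?_) j
        · simpa using hx
        · simpa using ht j
      · have := htE (fun j => φ j.succ)
        simp only [Lx, mem_filter, mem_univ, true_and] at this
        convert this (φ 0) using 1
        ext j
        refine Fin.cases ?_ (fun j => ?_) j <;> simp
    have hninj : (#{x : Fin m → α | ¬ Function.Injective x} : ℝ) * N ≤ (m : ℝ) ^ 2 * N ^ m := by
      have := card_not_injective_mul_le (ι := Fin m) (α := α)
      simp only [Fintype.card_fin, Fintype.card_pi, prod_const, card_univ] at this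
      rw [hNdef]; exact_mod_cast this
    have hLle : ∀ x, (#(Lx x) : ℝ) ≤ N ^ k := fun x => by
      rw [← hcardk]; exact_mod_cast card_le_card (subset_univ _)
    have hinjne : 0 < N ^ m := by positivity
    have hsum : ∑ x, (#(Lx x) : ℝ) ≤
        N ^ m * (κ ^ m / 2 * N ^ k) + #{x : Fin m → α | ¬ Function.Injective x} * N ^ k := by
      rw [← sum_filter_add_sum_filter_not univ (fun x : Fin m → α => Function.Injective x)]
      refine add_le_add ?_ ?_
      · refine (sum_le_card_nsmul _ _ (κ ^ m / 2 * N ^ k) ?_).trans ?_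
        · intro x hx
          exact (hbad x (by simpa using hx)).le
        · rw [nsmul_eq_mul]
          refine mul_le_mul_of_nonneg_right ?_ (by positivity)
          calc ((#(univ.filter fun x : Fin m → α => Function.Injective x) : ℕ) : ℝ)
              ≤ #(univ : Finset (Fin m → α)) := by exact_mod_cast card_le_card (subset_univ _)
            _ = N ^ m := by simp [hNdef]
      · refine (sum_le_card_nsmul _ _ (N ^ k) fun x _ => hLle x).trans ?_
        rw [nsmul_eq_mul]
    have hlow : κ ^ m * N ^ (k + m) ≤ ∑ x, (#(Lx x) : ℝ) := by
      rw [hdouble]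
      calc κ ^ m * N ^ (k + m) = N ^ k * (κ * N) ^ m := by ring
        _ ≤ _ := hjensen
    have hmain : κ ^ m / 2 * N ^ m ≤ #{x : Fin m → α | ¬ Function.Injective x} := by
      have : N ^ k * (κ ^ m / 2 * N ^ m) ≤
          N ^ k * #{x : Fin m → α | ¬ Function.Injective x} := by
        have e : κ ^ m * N ^ (k + m) = N ^ m * (κ ^ m / 2 * N ^ k)
          + N ^ k * (κ ^ m / 2 * N ^ m) := by ring
        linarith
      exact le_of_mul_le_mul_left this (by positivity)
    have h1 := (mul_le_mul_of_nonneg_right hmain hNR.le).trans hninj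
    have h2 : (m : ℝ) ^ 2 * 2 * N ^ m < κ ^ m * N * N ^ m :=
      mul_lt_mul_of_pos_right hN2 hinjne
    linarith

/-- `f` and `u` span an octahedron in `L`: every way of choosing, in each coordinate, the entry
of `f` or that of `u` gives an element of `L`. -/
def octPairs {K : ℕ} {α : Type*} [DecidableEq α] [Fintype α] (L : Finset (Fin K → α)) :
    Finset ((Fin K → α) × (Fin K → α)) :=
  {p | ∀ w, (∀ j, w j = p.1 j ∨ w j = p.2 j) → w ∈ L}

theorem sum_card_octPairs_le {K : ℕ} {α : Type*} [DecidableEq α] [Fintype α] (Y : Finset α)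
    (L : Finset (Fin (K + 1) → α)) :
    ∑ x ∈ Y ×ˢ Y, #(octPairs ({g | Fin.cons x.1 g ∈ L ∧ Fin.cons x.2 g ∈ L} :
      Finset (Fin K → α))) ≤ #(octPairs L) := by
  rw [← card_sigma]
  refine card_le_card_of_injOn (fun p => (Fin.cons p.1.1 p.2.1, Fin.cons p.1.2 p.2.2)) ?_ ?_
  · rintro ⟨⟨x, y⟩, f, u⟩ hp
    simp only [coe_sigma, Set.mem_sigma_iff, mem_coe, octPairs, mem_filter, mem_univ,
      true_and] at hp
    simp only [octPairs, coe_filter, mem_univ, true_and, Set.mem_ofPred_eq]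
    intro w hw
    have h1 := hp.2 (Fin.tail w) fun j => by simpa [Fin.tail] using hw j.succ
    have h2 := hw 0
    simp only [Fin.cons_zero] at h2
    rw [← Fin.cons_self_tail w]
    rcases h2 with h2 | h2 <;> rw [h2]
    exacts [h1.1, h1.2]
  · rintro ⟨⟨x, y⟩, f, u⟩ _ ⟨⟨x', y'⟩, f', u'⟩ _ h
    simp only [Prod.mk.injEq] at h
    obtain ⟨h1, h2⟩ := Fin.cons_injective2 h.1
    obtain ⟨h3, h4⟩ := Fin.cons_injective2 h.2
    subst h1 h2 h3 h4
    rfl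

theorem card_cons_mem {K : ℕ} {α : Type*} [DecidableEq α] [Fintype α] (Y : Finset α)
    (L : Finset (Fin (K + 1) → α)) (hL : L ⊆ Fintype.piFinset fun _ => Y) :
    #L = ∑ g ∈ Fintype.piFinset (fun _ : Fin K => Y),
      #{x ∈ Y | (Fin.cons x g : Fin (K + 1) → α) ∈ L} := by
  rw [← card_sigma]
  symm
  refine card_bij (fun p _ => Fin.cons p.2 p.1) ?_ ?_ ?_
  · rintro ⟨g, x⟩ h
    simp only [mem_sigma, mem_filter] at h
    exact h.2.2
  · rintro ⟨g, x⟩ _ ⟨g', x'⟩ _ h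
    obtain ⟨h2, h3⟩ := Fin.cons_injective2 h
    simp only at h2 h3
    subst h2 h3
    rfl
  · intro e he
    have h := Fintype.mem_piFinset.1 (hL he)
    exact ⟨⟨Fin.tail e, e 0⟩, by simp [Fin.cons_self_tail, he, Fin.tail, h],
      Fin.cons_self_tail e⟩

theorem pow_sum_le_of_pos {ι : Type*} (s : Finset ι) (f : ι → ℝ) (hf : ∀ i ∈ s, 0 ≤ f i)
    {p : ℕ} (hp : 0 < p) : #s * ((∑ i ∈ s, f i) / #s) ^ p ≤ ∑ i ∈ s, f i ^ p := by
  obtain ⟨q, rfl⟩ := Nat.exists_eq_succ_of_ne_zero hp.ne'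
  rcases s.eq_empty_or_nonempty with rfl | hs
  · simp
  have hs' : (0 : ℝ) < #s := by exact_mod_cast hs.card_pos
  refine le_trans (le_of_eq ?_) (pow_sum_div_card_le_sum_pow hf q)
  rw [div_pow, Nat.succ_eq_add_one, pow_succ (#s : ℝ) q]
  field_simp

theorem density_pow_le_octPairs {α : Type*} [DecidableEq α] [Fintype α] (Y : Finset α)
    (hY : Y.Nonempty) : ∀ (K : ℕ) (L : Finset (Fin K → α)),
    L ⊆ Fintype.piFinset (fun _ => Y) →
    ((#L : ℝ) / (#Y : ℝ) ^ K) ^ 2 ^ K ≤ #(octPairs L) / (#Y : ℝ) ^ (2 * K) := by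
  have hn : (0 : ℝ) < #Y := by exact_mod_cast hY.card_pos
  intro K
  induction K with
  | zero =>
    intro L _
    simp only [pow_zero, div_one, pow_one, mul_zero]
    refine Nat.cast_le.2 (card_le_card_of_injOn (fun x => (x, x)) (fun x hx => ?_) ?_)
    · simp only [octPairs, coe_filter, mem_univ, true_and, Set.mem_ofPred_eq]
      intro w _
      rwa [Subsingleton.elim w x]
    · intro x _ y _ h
      exact (Prod.ext_iff.1 h).1
  | succ K ih =>
    intro L hL
    let L2 : α × α → Finset (Fin K → α) := fun x =>
      {g | Fin.cons x.1 g ∈ L ∧ Fin.cons x.2 g ∈ L}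
    have hL2 : ∀ x, L2 x ⊆ Fintype.piFinset (fun _ => Y) := by
      intro x g hg
      simp only [L2, mem_filter] at hg
      have := Fintype.mem_piFinset.1 (hL hg.2.1)
      exact Fintype.mem_piFinset.2 fun j => by simpa using this j.succ
    have hdeg : ∑ x ∈ Y ×ˢ Y, (#(L2 x) : ℝ) = ∑ g ∈ Fintype.piFinset (fun _ : Fin K => Y),
        (#{x ∈ Y | (Fin.cons x g : Fin (K + 1) → α) ∈ L} : ℝ) ^ 2 := by
      have h1 : ∀ g : Fin K → α, #{x ∈ Y | (Fin.cons x g : Fin (K + 1) → α) ∈ L} ^ 2 =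
          #{x ∈ Y ×ˢ Y | (Fin.cons x.1 g : Fin (K + 1) → α) ∈ L ∧
            (Fin.cons x.2 g : Fin (K + 1) → α) ∈ L} := by
        intro g
        rw [sq, ← card_product, ← filter_product]
      have h2 : ∀ x, #(L2 x) = #{g ∈ Fintype.piFinset (fun _ : Fin K => Y) |
          Fin.cons x.1 g ∈ L ∧ Fin.cons x.2 g ∈ L} := by
        intro x
        congr 1
        ext g
        constructor
        · intro hg
          exact mem_filter.2 ⟨hL2 x hg, (mem_filter.1 hg).2⟩
        · intro hg
          exact mem_filter.2 ⟨mem_univ _, (mem_filter.1 hg).2⟩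
      simp_rw [← Nat.cast_pow, h1, h2, ← Nat.cast_sum]
      congr 1
      simp only [card_filter]
      exact sum_comm
    have hcs : ((#L : ℝ) / (#Y : ℝ) ^ (K + 1)) ^ 2 ≤
        (∑ x ∈ Y ×ˢ Y, (#(L2 x) : ℝ) / (#Y : ℝ) ^ K) / #(Y ×ˢ Y) := by
      have h := pow_sum_le_of_pos (Fintype.piFinset (fun _ : Fin K => Y))
        (fun g => (#{x ∈ Y | (Fin.cons x g : Fin (K + 1) → α) ∈ L} : ℝ))
        (fun _ _ => by positivity) (p := 2) two_pos
      rw [← hdeg, ← Nat.cast_sum, ← card_cons_mem Y L hL, Fintype.card_piFinset_const,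
        Nat.cast_pow] at h
      rw [← sum_div, card_product, le_div_iff₀ (by positivity), le_div_iff₀ (by positivity)]
      refine le_trans (le_of_eq ?_) h
      push_cast
      field_simp
      ring
    calc ((#L : ℝ) / (#Y : ℝ) ^ (K + 1)) ^ 2 ^ (K + 1)
        = (((#L : ℝ) / (#Y : ℝ) ^ (K + 1)) ^ 2) ^ 2 ^ K := by rw [← pow_mul, ← pow_succ' 2 K]
      _ ≤ ((∑ x ∈ Y ×ˢ Y, (#(L2 x) : ℝ) / (#Y : ℝ) ^ K) / #(Y ×ˢ Y)) ^ 2 ^ K := by gcongr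
      _ ≤ (∑ x ∈ Y ×ˢ Y, ((#(L2 x) : ℝ) / (#Y : ℝ) ^ K) ^ 2 ^ K) / #(Y ×ˢ Y) := by
        rw [le_div_iff₀ (by rw [card_product]; positivity), mul_comm]
        exact pow_sum_le_of_pos _ _ (fun _ _ => by positivity) (by positivity)
      _ ≤ (∑ x ∈ Y ×ˢ Y, (#(octPairs (L2 x)) : ℝ) / (#Y : ℝ) ^ (2 * K)) / #(Y ×ˢ Y) := by
        gcongr with x hx
        exact ih _ (hL2 x)
      _ ≤ (#(octPairs L) : ℝ) / (#Y : ℝ) ^ (2 * K) / #(Y ×ˢ Y) := by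
        rw [← sum_div]
        gcongr
        exact_mod_cast sum_card_octPairs_le Y L
      _ = _ := by
        rw [card_product]
        push_cast
        rw [mul_add, pow_add, mul_one]
        field_simp

/-- The tuples `u` such that all tuples mixed from `f` and `u` have the same colour as `f`. -/
def mixNbr {K : ℕ} {α β : Type*} [DecidableEq β] [DecidableEq α] [Fintype α]
    (c : (Fin K → α) → β) (f : Fin K → α) : Finset (Fin K → α) :=
  {u | ∀ w, (∀ j, w j = f j ∨ w j = u j) → c w = c f}

theorem card_large_mixNbr {K r : ℕ} {α : Type*} [DecidableEq α] [Fintype α] (Y : Finset α)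
    (hY : Y.Nonempty) (c : (Fin K → α) → Fin r) (hr : 0 < r) (c₁ : ℝ)
    (hc : c₁ = 2⁻¹ * ((r : ℝ)⁻¹) ^ 2 ^ K) :
    c₁ * (#Y : ℝ) ^ K ≤ #{f ∈ Fintype.piFinset (fun _ : Fin K => Y) |
      c₁ * (#Y : ℝ) ^ K ≤ #(mixNbr c f ∩ Fintype.piFinset fun _ => Y)} := by
  have hn : (0 : ℝ) < #Y := by exact_mod_cast hY.card_pos
  have hr' : (0 : ℝ) < r := by exact_mod_cast hr
  set P := Fintype.piFinset (fun _ : Fin K => Y) with hP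
  have hPc : (#P : ℝ) = (#Y : ℝ) ^ K := by rw [hP, Fintype.card_piFinset_const, Nat.cast_pow]
  obtain ⟨a, ha⟩ : ∃ a : Fin r, (#Y : ℝ) ^ K / r ≤ #{f ∈ P | c f = a} := by
    by_contra! hcon
    have h1 := card_eq_sum_card_fiberwise (f := c) (s := P) (t := univ) (fun _ _ => by simp)
    have h2 : (#P : ℝ) < ∑ a : Fin r, (#Y : ℝ) ^ K / r := by
      rw [h1, Nat.cast_sum]
      exact sum_lt_sum_of_nonempty ⟨⟨0, hr⟩, mem_univ _⟩ fun a _ => hcon a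
    rw [hPc] at h2
    simp only [sum_const, card_univ, Fintype.card_fin, nsmul_eq_mul] at h2
    rw [mul_div_cancel₀ _ hr'.ne'] at h2
    exact lt_irrefl _ h2
  set La : Finset (Fin K → α) := {f ∈ P | c f = a} with hLa
  have h3 := density_pow_le_octPairs Y hY K La (filter_subset _ _)
  have h4 : 2 * c₁ * (#Y : ℝ) ^ (2 * K) ≤ #(octPairs La) := by
    rw [← le_div_iff₀ (by positivity)]
    refine le_trans ?_ h3
    rw [hc]
    have : (r : ℝ)⁻¹ ≤ #La / (#Y : ℝ) ^ K := by
      rw [le_div_iff₀ (by positivity)]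
      calc _ = (#Y : ℝ) ^ K / r := by ring
        _ ≤ _ := ha
    calc 2 * (2⁻¹ * (r : ℝ)⁻¹ ^ 2 ^ K) = (r : ℝ)⁻¹ ^ 2 ^ K := by ring
      _ ≤ _ := by gcongr
  have h5 : #(octPairs La) ≤ ∑ f ∈ P, #(mixNbr c f ∩ P) := by
    rw [← card_sigma]
    refine card_le_card_of_injOn (fun p => ⟨p.1, p.2⟩) ?_ ?_
    · rintro ⟨f, u⟩ hp
      simp only [octPairs, coe_filter, mem_univ, true_and, Set.mem_ofPred_eq] at hp
      have hf := hp f fun j => Or.inl rfl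
      have hu := hp u fun j => Or.inr rfl
      simp only [hLa, mem_filter] at hf hu
      simp only [coe_sigma, Set.mem_sigma_iff, mem_coe, mem_inter, mixNbr, mem_filter, mem_univ,
        true_and]
      refine ⟨hf.1, fun w hw => ?_, hu.1⟩
      have := hp w hw
      simp only [hLa, mem_filter] at this
      rw [this.2, hf.2]
    · rintro ⟨f, u⟩ _ ⟨f', u'⟩ _ h
      simp only [Sigma.mk.injEq, heq_eq_eq] at h
      exact Prod.ext h.1 h.2
  by_contra! hlt
  have h6 : ∑ f ∈ P, (#(mixNbr c f ∩ P) : ℝ) <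
      c₁ * (#Y : ℝ) ^ K * (#Y : ℝ) ^ K + (#Y : ℝ) ^ K * (c₁ * (#Y : ℝ) ^ K) := by
    rw [← sum_filter_add_sum_filter_not P (fun f => c₁ * (#Y : ℝ) ^ K ≤ #(mixNbr c f ∩ P))]
    refine add_lt_add_of_lt_of_le ?_ ?_
    · refine (sum_le_card_nsmul _ _ ((#Y : ℝ) ^ K) fun f _ => ?_).trans_lt ?_
      · rw [← hPc]
        exact_mod_cast card_le_card inter_subset_right
      · rw [nsmul_eq_mul]
        exact mul_lt_mul_of_pos_right hlt (by positivity)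
    · refine (sum_le_card_nsmul _ _ (c₁ * (#Y : ℝ) ^ K) fun f hf => ?_).trans ?_
      · exact (not_le.1 (mem_filter.1 hf).2).le
      · rw [nsmul_eq_mul, ← hPc]
        refine mul_le_mul_of_nonneg_right ?_ (by rw [hc]; positivity)
        exact_mod_cast card_le_card (filter_subset _ _)
  have h7 : (#(octPairs La) : ℝ) ≤ ∑ f ∈ P, (#(mixNbr c f ∩ P) : ℝ) := by exact_mod_cast h5
  have h8 : 2 * c₁ * (#Y : ℝ) ^ (2 * K) =
    c₁ * (#Y : ℝ) ^ K * (#Y : ℝ) ^ K + (#Y : ℝ) ^ K * (c₁ * (#Y : ℝ) ^ K) := by ring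
  linarith

/-- Among sufficiently many sets of density at least `d`, two meet in density `d ^ 2 / 2`. -/
theorem exists_large_inter {ι β : Type*} [DecidableEq ι] [DecidableEq β] (I : Finset ι)
    (W : Finset β) (hW : W.Nonempty) (Z : ι → Finset β) (hZ : ∀ i ∈ I, Z i ⊆ W) (d : ℝ) (hd : 0 < d)
    (hlarge : ∀ i ∈ I, d * #W ≤ #(Z i)) (hI : 2 / d ≤ #I) :
    ∃ i ∈ I, ∃ j ∈ I, i ≠ j ∧ d ^ 2 / 2 * #W ≤ #(Z i ∩ Z j) := by
  by_contra! hcon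
  have hWp : (0 : ℝ) < #W := by exact_mod_cast hW.card_pos
  have hIp : (0 : ℝ) < #I := lt_of_lt_of_le (by positivity) hI
  have hZc : ∀ i ∈ I, #(Z i) = ∑ u ∈ W, if u ∈ Z i then 1 else 0 := by
    intro i hi
    rw [← card_filter]
    congr 1
    ext u
    simp only [mem_filter]
    exact ⟨fun h => ⟨hZ i hi h, h⟩, fun h => h.2⟩
  have hsum : ∑ i ∈ I, (#(Z i) : ℝ) = ∑ u ∈ W, (#{i ∈ I | u ∈ Z i} : ℝ) := by
    rw [← Nat.cast_sum, ← Nat.cast_sum, sum_congr rfl hZc, sum_comm]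
    simp only [card_filter]
  have hsq : ∑ i ∈ I, ∑ j ∈ I, (#(Z i ∩ Z j) : ℝ) = ∑ u ∈ W, (#{i ∈ I | u ∈ Z i} : ℝ) ^ 2 := by
    have h1 : ∀ u, #{i ∈ I | u ∈ Z i} ^ 2 =
        ∑ i ∈ I, ∑ j ∈ I, if u ∈ Z i ∩ Z j then 1 else 0 := by
      intro u
      rw [sq, card_filter, sum_mul_sum]
      refine sum_congr rfl fun i _ => sum_congr rfl fun j _ => ?_
      simp only [mem_inter, ite_and, mul_ite, mul_one, mul_zero]
      split_ifs <;> rfl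
    have h2 : ∀ i ∈ I, ∀ j ∈ I, #(Z i ∩ Z j) = ∑ u ∈ W, if u ∈ Z i ∩ Z j then 1 else 0 := by
      intro i hi j _
      rw [← card_filter]
      congr 1
      ext u
      simp only [mem_filter]
      exact ⟨fun h => ⟨hZ i hi (mem_inter.1 h).1, h⟩, fun h => h.2⟩
    simp_rw [← Nat.cast_pow, h1, ← Nat.cast_sum]
    congr 1
    rw [sum_comm (s := W)]
    refine sum_congr rfl fun i hi => ?_
    rw [sum_comm (s := W)]
    exact sum_congr rfl fun j hj => h2 i hi j hj
  have hJ := pow_sum_le_of_pos W (fun u => (#{i ∈ I | u ∈ Z i} : ℝ)) (fun _ _ => by positivity)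
    (p := 2) two_pos
  rw [← hsq, ← hsum] at hJ
  have hup : ∑ i ∈ I, ∑ j ∈ I, (#(Z i ∩ Z j) : ℝ) <
      ∑ i ∈ I, (#(Z i) : ℝ) + #I * (#I * (d ^ 2 / 2 * #W)) := by
    have : ∀ i ∈ I, ∑ j ∈ I, (#(Z i ∩ Z j) : ℝ) < #(Z i) + #I * (d ^ 2 / 2 * #W) := by
      intro i hi
      rw [← add_sum_erase I _ hi, inter_self]
      refine add_lt_add_right ?_ _
      refine (sum_le_card_nsmul (I.erase i) (fun j => (#(Z i ∩ Z j) : ℝ)) (d ^ 2 / 2 * #W)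
        fun j hj => ?_).trans_lt ?_
      · exact (hcon i hi j (mem_of_mem_erase hj) (ne_of_mem_erase hj).symm).le
      · rw [nsmul_eq_mul]
        refine mul_lt_mul_of_pos_right ?_ (by positivity)
        exact_mod_cast card_erase_lt_of_mem hi
    calc _ < ∑ i ∈ I, ((#(Z i) : ℝ) + #I * (d ^ 2 / 2 * #W)) :=
          sum_lt_sum_of_nonempty (card_pos.1 (by exact_mod_cast hIp)) this
      _ = _ := by rw [sum_add_distrib, sum_const, nsmul_eq_mul]
  have hlow : #I * (d * #W) ≤ ∑ i ∈ I, (#(Z i) : ℝ) := by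
    rw [← nsmul_eq_mul (α := ℝ)]
    exact card_nsmul_le_sum I (fun i => (#(Z i) : ℝ)) _ hlarge
  set S := ∑ i ∈ I, (#(Z i) : ℝ) with hS
  have hI2 : 2 ≤ #I * d := (div_le_iff₀ hd).1 hI
  have e : (#W : ℝ) * (S / #W) ^ 2 = S ^ 2 / #W := by field_simp
  rw [e] at hJ
  have h9 : S ^ 2 < (S + #I * (#I * (d ^ 2 / 2 * #W))) * #W := by
    rw [← div_lt_iff₀ hWp]
    linarith
  set a := (#I : ℝ) * d with ha
  have hS' : a * #W ≤ S := by rw [ha]; linarith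
  have h10 : S ^ 2 < S * #W + a ^ 2 / 2 * (#W : ℝ) ^ 2 := by
    calc S ^ 2 < _ := h9
      _ = _ := by rw [ha]; ring
  nlinarith [mul_le_mul_of_nonneg_right hI2 hWp.le, mul_nonneg (sub_nonneg.2 hS') hWp.le,
    mul_nonneg (sub_nonneg.2 hS') (sub_nonneg.2 hS'),
    mul_nonneg (sub_nonneg.2 hS') (mul_nonneg (sub_nonneg.2 hI2) hWp.le)]

/-- The number of tuples in `A` all of whose entries get the label `s` from `h`. -/
def labelCount {K : ℕ} {α σ : Type*} [DecidableEq σ] (h : α → σ) (s : σ)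
    (A : Finset (Fin K → α)) : ℕ :=
  #{u ∈ A | ∀ j, h (u j) = s}

/-- The relabelling which exchanges two given labels on `Q`. -/
def swapOn {α σ : Type*} [DecidableEq α] [DecidableEq σ] (Q : Finset α) (s s' : σ) (h : α → σ) :
    α → σ :=
  fun v => if v ∈ Q then Equiv.swap s s' (h v) else h v

theorem swapOn_involutive {α σ : Type*} [DecidableEq α] [DecidableEq σ] (Q : Finset α)
    (s s' : σ) : Function.Involutive (swapOn Q s s') := by
  intro h
  funext v
  by_cases hv : v ∈ Q <;> simp [swapOn, hv]

/-- The difference of the indicators of `u` being labelled entirely by the first and entirely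
by the second of two labels. -/
def labelDiff {K : ℕ} {α σ : Type*} [DecidableEq σ] (s s' : σ) (u : Fin K → α) (h : α → σ) : ℝ :=
  (if ∀ j, h (u j) = s then 1 else 0) - (if ∀ j, h (u j) = s' then 1 else 0)

theorem labelCount_sub_labelCount {K : ℕ} {α σ : Type*} [DecidableEq σ] (h : α → σ) (s s' : σ)
    (A : Finset (Fin K → α)) :
    (labelCount h s A : ℝ) - labelCount h s' A = ∑ u ∈ A, labelDiff s s' u h := by
  simp only [labelCount, labelDiff, card_filter, sum_sub_distrib]
  push_cast
  rfl

theorem abs_labelDiff_le {K : ℕ} {α σ : Type*} [DecidableEq σ] (s s' : σ) (u : Fin K → α)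
    (h : α → σ) : |labelDiff s s' u h| ≤ 1 := by
  unfold labelDiff
  split_ifs <;> norm_num

theorem labelDiff_swapOn_of_subset {K : ℕ} {α σ : Type*} [DecidableEq α] [DecidableEq σ]
    (s s' : σ) (u : Fin K → α) (h : α → σ) (Q : Finset α) (hQ : ∀ j, u j ∈ Q) :
    labelDiff s s' u (swapOn Q s s' h) = - labelDiff s s' u h := by
  have h1 : ∀ j, swapOn Q s s' h (u j) = s ↔ h (u j) = s' := fun j => by
    rw [swapOn, if_pos (hQ j), Equiv.swap_apply_eq_iff, Equiv.swap_apply_left]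
  have h2 : ∀ j, swapOn Q s s' h (u j) = s' ↔ h (u j) = s := fun j => by
    rw [swapOn, if_pos (hQ j), Equiv.swap_apply_eq_iff, Equiv.swap_apply_right]
  simp only [labelDiff, h1, h2, neg_sub]

theorem labelDiff_swapOn_of_disjoint {K : ℕ} {α σ : Type*} [DecidableEq α] [DecidableEq σ]
    (s s' : σ) (u : Fin K → α) (h : α → σ) (Q : Finset α) (hQ : ∀ j, u j ∉ Q) :
    labelDiff s s' u (swapOn Q s s' h) = labelDiff s s' u h := by
  simp only [labelDiff, swapOn, hQ, if_false]

theorem sum_labelDiff_mul {K : ℕ} {α σ : Type*} [Fintype α] [DecidableEq α] [Fintype σ]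
    [DecidableEq σ] (s s' : σ) (u u' : Fin K → α) (hu : ∀ i, u' i ∉ univ.image u) :
    ∑ h : α → σ, labelDiff s s' u h * labelDiff s s' u' h = 0 := by
  have := Equiv.sum_comp (swapOn_involutive (univ.image u) s s').toPerm
    fun h : α → σ => labelDiff s s' u h * labelDiff s s' u' h
  simp only [Function.Involutive.coe_toPerm,
    labelDiff_swapOn_of_disjoint s s' u' _ _ hu,
    labelDiff_swapOn_of_subset s s' u _ _ fun j => mem_image_of_mem u (mem_univ j)] at this
  simp only [neg_mul, sum_neg_distrib] at this
  linarith

theorem sum_sq_labelCount_sub_le {K : ℕ} {α σ : Type*} [Fintype α] [DecidableEq α] [Fintype σ]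
    [DecidableEq σ] (s s' : σ) (A : Finset (Fin K → α)) :
    (∑ h : α → σ, ((labelCount h s A : ℝ) - labelCount h s' A) ^ 2) * Fintype.card α ≤
      Fintype.card (α → σ) * ((K : ℝ) ^ 2 * (Fintype.card α : ℝ) ^ (2 * K)) := by
  have h1 : ∑ h : α → σ, ((labelCount h s A : ℝ) - labelCount h s' A) ^ 2 =
      ∑ u ∈ A, ∑ u' ∈ A, ∑ h : α → σ, labelDiff s s' u h * labelDiff s s' u' h := by
    simp_rw [labelCount_sub_labelCount, sq, sum_mul_sum]
    rw [sum_comm]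
    refine sum_congr rfl fun u _ => ?_
    rw [sum_comm]
  have h2 : ∀ u u' : Fin K → α, ∑ h : α → σ, labelDiff s s' u h * labelDiff s s' u' h ≤
      if ∃ i, u' i ∈ univ.image u then (Fintype.card (α → σ) : ℝ) else 0 := by
    intro u u'
    split_ifs with hc
    · rw [← card_univ, ← mul_one ((#(univ : Finset (α → σ)) : ℕ) : ℝ), ← nsmul_eq_mul]
      refine sum_le_card_nsmul _ _ _ fun h _ => ?_
      refine (le_abs_self _).trans ?_
      rw [abs_mul]
      exact mul_le_one₀ (abs_labelDiff_le _ _ _ _) (abs_nonneg _) (abs_labelDiff_le _ _ _ _)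
    · push Not at hc
      exact (sum_labelDiff_mul s s' u u' hc).le
  have h3 : ∀ u : Fin K → α, (∑ u' ∈ A, if ∃ i, u' i ∈ univ.image u then
      (Fintype.card (α → σ) : ℝ) else 0) * Fintype.card α ≤
      Fintype.card (α → σ) * ((K : ℝ) ^ 2 * (Fintype.card α : ℝ) ^ K) := by
    intro u
    have h4 : #{u' : Fin K → α | ∃ i, u' i ∈ univ.image u} * Fintype.card α ≤
        Fintype.card (Fin K) * (#(univ.image u) * Fintype.card (Fin K → α)) := by
      convert card_meets_mul_le (ι := Fin K) (univ.image u)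
    have h5 : #(univ.image u) ≤ K := card_image_le.trans (by simp)
    have h6 : #{u' ∈ A | ∃ i, u' i ∈ univ.image u} * Fintype.card α ≤
        K ^ 2 * Fintype.card α ^ K := by
      calc _ ≤ #{u' : Fin K → α | ∃ i, u' i ∈ univ.image u} * Fintype.card α :=
            Nat.mul_le_mul_right _ (card_le_card (filter_subset_filter _ (subset_univ _)))
        _ ≤ Fintype.card (Fin K) * (K * Fintype.card (Fin K → α)) :=
            h4.trans (Nat.mul_le_mul_left _ (Nat.mul_le_mul_right _ h5))
        _ = _ := by
          simp only [Fintype.card_fin, Fintype.card_pi, prod_const, card_univ]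
          ring
    rw [← sum_filter, sum_const, nsmul_eq_mul, mul_comm (#_ : ℝ), mul_assoc]
    refine mul_le_mul_of_nonneg_left ?_ (by positivity)
    exact_mod_cast h6
  rw [h1]
  calc _ ≤ (∑ u ∈ A, ∑ u' ∈ A, if ∃ i, u' i ∈ univ.image u then
        (Fintype.card (α → σ) : ℝ) else 0) * Fintype.card α := by
        gcongr with u _ u' _
        exact h2 u u'
    _ ≤ ∑ u ∈ A, Fintype.card (α → σ) * ((K : ℝ) ^ 2 * (Fintype.card α : ℝ) ^ K) := by
        rw [sum_mul]
        exact sum_le_sum fun u _ => h3 u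
    _ ≤ (Fintype.card α : ℝ) ^ K *
        (Fintype.card (α → σ) * ((K : ℝ) ^ 2 * (Fintype.card α : ℝ) ^ K)) := by
        rw [sum_const, nsmul_eq_mul]
        refine mul_le_mul_of_nonneg_right ?_ (by positivity)
        have : #A ≤ Fintype.card α ^ K := (card_le_univ A).trans (by simp)
        exact_mod_cast this
    _ = _ := by ring

theorem labelCount_univ {α σ : Type*} [Fintype α] [DecidableEq α] [DecidableEq σ] (h : α → σ)
    (s : σ) (K : ℕ) : labelCount h s (univ : Finset (Fin K → α)) = #{v | h v = s} ^ K := by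
  rw [← Fintype.card_piFinset_const, labelCount]
  congr 1
  ext u
  simp [Fintype.mem_piFinset]

/-- There is a labelling of the vertices which is almost equitable on the vertex set, and almost
equitable on average over a family of sets of tuples. -/
theorem exists_balanced_labelling {K : ℕ} {α σ ι : Type*} [Fintype α] [DecidableEq α] [Fintype σ]
    [DecidableEq σ] [Fintype ι] [Nonempty α] (s₀ : σ) (A : ι → Finset (Fin K → α)) :
    ∃ h : α → σ, ∀ s,
      ((#{v | h v = s} : ℝ) - #{v | h v = s₀}) ^ 2 ≤ 2 * Fintype.card σ * Fintype.card α ∧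
      (∑ i, ((labelCount h s (A i) : ℝ) - labelCount h s₀ (A i)) ^ 2) * Fintype.card α ≤
        2 * Fintype.card σ * (Fintype.card ι * ((K : ℝ) ^ 2 * (Fintype.card α : ℝ) ^ (2 * K))) := by
  have hN : (0 : ℝ) < Fintype.card α := by exact_mod_cast Fintype.card_pos
  have hq : (0 : ℝ) < Fintype.card σ := by exact_mod_cast Fintype.card_pos_iff.2 ⟨s₀⟩
  have hT : (0 : ℝ) < Fintype.card (α → σ) := by
    exact_mod_cast Fintype.card_pos_iff.2 ⟨fun _ => s₀⟩
  let F : (α → σ) → ℝ := fun h => ∑ s, ((#{v | h v = s} : ℝ) - #{v | h v = s₀}) ^ 2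
  let G : (α → σ) → ℝ := fun h =>
    (∑ s, ∑ i, ((labelCount h s (A i) : ℝ) - labelCount h s₀ (A i)) ^ 2) * Fintype.card α
  set a : ℝ := Fintype.card σ * Fintype.card α with ha
  set b : ℝ := Fintype.card σ * (Fintype.card ι * ((K : ℝ) ^ 2 * (Fintype.card α : ℝ) ^ (2 * K)))
    with hb
  have hF : ∑ h, F h ≤ Fintype.card (α → σ) * a := by
    simp only [F]
    rw [sum_comm]
    have : ∀ s, ∑ h : α → σ, ((#{v | h v = s} : ℝ) - #{v | h v = s₀}) ^ 2 ≤
        Fintype.card (α → σ) * Fintype.card α := by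
      intro s
      have h1 := sum_sq_labelCount_sub_le s s₀ (univ : Finset (Fin 1 → α))
      simp only [labelCount_univ, pow_one, Nat.cast_one, one_pow, one_mul, mul_one] at h1
      refine le_of_mul_le_mul_right (h1.trans (le_of_eq ?_)) hN
      ring
    refine (sum_le_sum fun s _ => this s).trans (le_of_eq ?_)
    rw [sum_const, card_univ, nsmul_eq_mul, ha]
    ring
  have hG : ∑ h, G h ≤ Fintype.card (α → σ) * b := by
    simp only [G]
    rw [← sum_mul, sum_comm]
    have : ∀ s, ∑ h : α → σ, ∑ i, ((labelCount h s (A i) : ℝ) - labelCount h s₀ (A i)) ^ 2 ≤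
        (Fintype.card ι * (Fintype.card (α → σ) *
          ((K : ℝ) ^ 2 * (Fintype.card α : ℝ) ^ (2 * K)))) / Fintype.card α := by
      intro s
      rw [sum_comm, le_div_iff₀ hN, sum_mul]
      refine (sum_le_sum fun i _ => sum_sq_labelCount_sub_le s s₀ (A i)).trans (le_of_eq ?_)
      rw [sum_const, card_univ, nsmul_eq_mul]
    refine (mul_le_mul_of_nonneg_right (sum_le_sum fun s _ => this s) hN.le).trans (le_of_eq ?_)
    rw [sum_const, card_univ, nsmul_eq_mul, hb]
    field_simp
  have hFn : ∀ h, 0 ≤ F h := fun h => by positivity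
  have hGn : ∀ h, 0 ≤ G h := fun h => by positivity
  have ha0 : 0 < a := by positivity
  have hb0 : 0 ≤ b := by positivity
  have key : ∃ h, F h ≤ 2 * a ∧ G h ≤ 2 * b := by
    by_contra! hcon
    rcases hb0.eq_or_lt with hb1 | hb1
    · have hG0 : ∀ h, G h = 0 := by
        intro h
        rw [← hb1, mul_zero] at hG
        exact le_antisymm ((single_le_sum (fun h _ => hGn h) (mem_univ h)).trans hG) (hGn h)
      have : ∑ h : α → σ, 2 * a < ∑ h, F h := by
        refine sum_lt_sum_of_nonempty ⟨fun _ => s₀, mem_univ _⟩ fun h _ => ?_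
        by_contra hle
        have := hcon h (not_lt.1 hle)
        rw [hG0, ← hb1] at this
        simp at this
      rw [sum_const, card_univ, nsmul_eq_mul] at this
      nlinarith
    · have : ∑ h : α → σ, (2 : ℝ) < ∑ h, (F h / a + G h / b) := by
        refine sum_lt_sum_of_nonempty ⟨fun _ => s₀, mem_univ _⟩ fun h _ => ?_
        by_cases h1 : F h ≤ 2 * a
        · have h2 := (lt_div_iff₀ hb1).2 (hcon h h1)
          have h3 := div_nonneg (hFn h) ha0.le
          linarith
        · have h2 := (lt_div_iff₀ ha0).2 (not_le.1 h1)
          have h3 := div_nonneg (hGn h) hb0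
          linarith
      rw [sum_add_distrib, ← sum_div, ← sum_div, sum_const, card_univ, nsmul_eq_mul] at this
      have h1 := (div_le_iff₀ ha0).2 hF
      have h2 := (div_le_iff₀ hb1).2 hG
      linarith
  obtain ⟨h, h1, h2⟩ := key
  refine ⟨h, fun s => ⟨?_, ?_⟩⟩
  · refine (single_le_sum (f := fun s => ((#{v | h v = s} : ℝ) - #{v | h v = s₀}) ^ 2)
      (fun _ _ => by positivity) (mem_univ s)).trans (h1.trans (le_of_eq ?_))
    rw [ha]
    ring
  · refine le_trans ?_ (h2.trans (le_of_eq ?_))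
    · refine mul_le_mul_of_nonneg_right ?_ hN.le
      exact single_le_sum
        (f := fun s => ∑ i, ((labelCount h s (A i) : ℝ) - labelCount h s₀ (A i)) ^ 2)
        (fun _ _ => by positivity) (mem_univ s)
    · rw [hb]
      ring

section Pieces

variable {α β : Type*} [DecidableEq α] {K : ℕ}

/-- The colour of the edge consisting of the vertex `v` and the entries of `f`. -/
def edgeCol (χ : Finset α → β) (v : α) (f : Fin K → α) : β :=
  χ (insert v (univ.image f))

/-- A cell is a tuple of `K + 1` vertices. A cell may follow another one in a tight path of colour
`c` if its head has colour `c` with every tuple mixed from the tails of the two cells. -/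
def CellRel (χ : Finset α → β) (c : β) (e e' : Fin (K + 1) → α) : Prop :=
  ∀ w : Fin K → α, (∀ j, w j = e j.succ ∨ w j = e' j.succ) → edgeCol χ (e' 0) w = c

/-- A piece is a tight path, given by its list of cells together with one final vertex, which can
be entered from and continued to every tuple in `Z`. -/
structure IsPiece (χ : Finset α → β) (c : β) (Z : Finset (Fin K → α))
    (p : List (Fin (K + 1) → α) × α) : Prop where
  nodup : (p.1.flatMap List.ofFn ++ [p.2]).Nodup
  chain : ∀ a, ∀ u ∈ Z, ∀ u' ∈ Z,
    ((Fin.cons a u : Fin (K + 1) → α) :: (p.1 ++ [Fin.cons p.2 u'])).IsChain (CellRel χ c)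

/-- The set of vertices of a piece. -/
def pieceSupp (p : List (Fin (K + 1) → α) × α) : Finset α :=
  (p.1.flatMap List.ofFn ++ [p.2]).toFinset

theorem edgeCol_succ (χ : Finset α → β) (e : Fin (K + 1) → α) :
    edgeCol χ (e 0) (fun j => e j.succ) = χ (univ.image e) := by
  unfold edgeCol
  congr 1
  ext v
  simp only [mem_insert, mem_image, mem_univ, true_and]
  constructor
  · rintro (rfl | ⟨j, rfl⟩)
    exacts [⟨0, rfl⟩, ⟨j.succ, rfl⟩]
  · rintro ⟨j, rfl⟩
    refine Fin.cases (Or.inl rfl) (fun j => Or.inr ⟨j, rfl⟩) j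

theorem cellRel_of_grid {m : ℕ} {χ : Finset α → β} {c : β} {t : Fin (K + 1) → Fin m → α}
    (hc : ∀ φ : Fin (K + 1) → Fin m, χ (univ.image fun j => t j (φ j)) = c)
    (φ φ' : Fin (K + 1) → Fin m) :
    CellRel χ c (fun j => t j (φ j)) (fun j => t j (φ' j)) := by
  intro w hw
  have : ∀ j : Fin K, ∃ z, w j = t j.succ z := fun j => by
    rcases hw j with h | h
    exacts [⟨_, h⟩, ⟨_, h⟩]
  choose ψ hψ using this
  have h := hc (Fin.cons (φ' 0) ψ)
  rw [← edgeCol_succ χ fun j => t j ((Fin.cons (φ' 0) ψ : Fin (K + 1) → Fin m) j)] at h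
  simp only [Fin.cons_zero, Fin.cons_succ] at h
  rwa [funext hψ]

theorem exists_piece_of_grid [Fintype α] [DecidableEq β] {m : ℕ} (hm : 3 ≤ m) {d : ℝ} (hd : 0 < d)
    (hdm : 2 / d ≤ m)
    {χ : Finset α → β} {c : β} {t : Fin (K + 1) → Fin m → α}
    (ht : Function.Injective (Function.uncurry t))
    (hc : ∀ φ : Fin (K + 1) → Fin m, χ (univ.image fun j => t j (φ j)) = c)
    {W : Finset (Fin K → α)} (hW : W.Nonempty)
    (hZ : ∀ z, d * #W ≤ #(mixNbr (edgeCol χ (t 0 z)) (fun j => t j.succ z) ∩ W)) :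
    ∃ p Z, IsPiece χ c Z p ∧ Z ⊆ W ∧ d ^ 2 / 2 * #W ≤ #Z ∧
      pieceSupp p ⊆ univ.image (Function.uncurry t) ∧ univ.image (t 0) ⊆ pieceSupp p := by
  obtain ⟨a, -, a', -, haa, hlarge⟩ := exists_large_inter (univ : Finset (Fin m)) W hW
    (fun z => mixNbr (edgeCol χ (t 0 z)) (fun j => t j.succ z) ∩ W)
    (fun _ _ => inter_subset_right) d hd (fun z _ => hZ z) (by simpa using hdm)
  obtain ⟨y, hy⟩ : ∃ y, y ∉ ({a, a'} : Finset (Fin m)) := by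
    by_contra! h
    have h1 : #(univ : Finset (Fin m)) ≤ #({a, a'} : Finset (Fin m)) :=
      card_le_card fun z _ => h z
    have h2 := card_le_two (a := a) (b := a')
    rw [card_univ, Fintype.card_fin] at h1
    omega
  simp only [mem_insert, mem_singleton, not_or] at hy
  obtain ⟨hya, hya'⟩ := hy
  have hcol : ∀ z, edgeCol χ (t 0 z) (fun j => t j.succ z) = c := fun z => by
    rw [edgeCol_succ χ fun j => t j z]
    exact hc fun _ => z
  have htj : ∀ {i j x y}, t i x = t j y → i = j ∧ x = y := fun {i j x y} h => by
    have := @ht (i, x) (j, y) h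
    simpa using this
  let row : Fin m → Fin (K + 1) → α := fun z j => t j z
  let zs : List (Fin m) := (((univ.erase a).erase a').erase y).toList
  let last : Fin (K + 1) → α := fun j => t j ((Fin.cons y fun _ => a' : Fin (K + 1) → Fin m) j)
  let l : List (Fin (K + 1) → α) := row a :: (zs.map row ++ [last])
  have hzs : ∀ z, z ∈ zs ↔ z ≠ y ∧ z ≠ a' ∧ z ≠ a := fun z => by
    simp [zs]
  have hgrid : ∀ e ∈ l, ∃ φ : Fin (K + 1) → Fin m, e = fun j => t j (φ j) := by
    intro e he
    simp only [l, List.mem_cons, List.mem_append, List.mem_map, List.not_mem_nil, or_false] at he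
    rcases he with rfl | ⟨z, -, rfl⟩ | rfl
    exacts [⟨_, rfl⟩, ⟨fun _ => z, rfl⟩, ⟨_, rfl⟩]
  have hlast0 : last 0 = t 0 y := rfl
  have hlasts : ∀ j : Fin K, last j.succ = t j.succ a' := fun _ => rfl
  refine ⟨(l, t 0 a'), _, ⟨?_, ?_⟩, inter_subset_left.trans inter_subset_right, hlarge, ?_, ?_⟩
  · have hinj : ∀ φ : Fin (K + 1) → Fin m, (List.ofFn fun j => t j (φ j)).Nodup := fun φ =>
      List.nodup_ofFn.2 fun i j h => (htj h).1
    have hdis : ∀ φ φ' : Fin (K + 1) → Fin m, (∀ j, φ j ≠ φ' j) →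
        List.Disjoint (List.ofFn fun j => t j (φ j)) (List.ofFn fun j => t j (φ' j)) := by
      intro φ φ' h x hx hx'
      simp only [List.mem_ofFn] at hx hx'
      obtain ⟨i, rfl⟩ := hx
      obtain ⟨j, hj⟩ := hx'
      obtain ⟨rfl, h2⟩ := htj hj
      exact h _ h2.symm
    refine List.nodup_append.2 ⟨List.nodup_flatMap.2 ⟨?_, ?_⟩, List.nodup_singleton _, ?_⟩
    · intro e he
      obtain ⟨φ, rfl⟩ := hgrid e he
      exact hinj φ
    · refine List.pairwise_cons.2 ⟨?_, List.pairwise_append.2 ⟨?_, List.pairwise_singleton _ _, ?_⟩⟩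
      · intro e he
        simp only [List.mem_append, List.mem_map, List.mem_singleton] at he
        rcases he with ⟨z, hz, rfl⟩ | rfl
        · exact hdis _ _ fun _ => (((hzs z).1 hz).2.2).symm
        · refine hdis _ _ fun j => ?_
          refine Fin.cases ?_ (fun j => ?_) j
          exacts [Ne.symm hya, haa]
      · rw [List.pairwise_map]
        refine (Finset.nodup_toList _).imp fun {z z'} hzz => ?_
        exact hdis _ _ fun _ => hzz
      · intro e he e' he'
        simp only [List.mem_map, List.mem_singleton] at he he'
        obtain ⟨z, hz, rfl⟩ := he
        subst he'
        refine hdis _ _ fun j => ?_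
        refine Fin.cases ?_ (fun j => ?_) j
        exacts [((hzs z).1 hz).1, ((hzs z).1 hz).2.1]
    · intro x hx x' hx' hxx
      rw [List.mem_singleton] at hx'
      subst hx'
      subst hxx
      rw [List.mem_flatMap] at hx
      obtain ⟨e, he, hx⟩ := hx
      rw [List.mem_ofFn] at hx
      obtain ⟨j, hj⟩ := hx
      simp only [l, List.mem_cons, List.mem_append, List.mem_map, List.not_mem_nil, or_false] at he
      rcases he with rfl | ⟨z, hz, rfl⟩ | rfl
      · exact haa (htj hj).2
      · exact ((hzs z).1 hz).2.1 (htj hj).2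
      · obtain ⟨rfl, h2⟩ := htj hj
        exact hya' h2
  · intro x u hu u' hu'
    have hu1 := (mem_inter.1 (mem_inter.1 hu).1).1
    have hu2 := (mem_inter.1 (mem_inter.1 hu').2).1
    simp only [mixNbr, mem_filter, mem_univ, true_and] at hu1 hu2
    show List.IsChain _ (_ :: row a :: (zs.map row ++ [last] ++ [_]))
    rw [List.isChain_cons_cons]
    refine ⟨fun w hw => ?_, ?_⟩
    · refine (hu1 w fun j => ?_).trans (hcol a)
      simpa using (hw j).symm
    · have : (row a :: (zs.map row ++ [last] ++ [(Fin.cons (t 0 a') u' : Fin (K + 1) → α)])) =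
          (row a :: zs.map row) ++ last :: Fin.cons (t 0 a') u' :: [] := by simp
      rw [this, List.isChain_append_cons_cons]
      refine ⟨List.Pairwise.isChain (List.pairwise_of_forall_mem_list fun e he e' he' => ?_),
        fun w hw => ?_, List.isChain_singleton _⟩
      · obtain ⟨φ, rfl⟩ := hgrid e (by simpa [l] using he)
        obtain ⟨φ', rfl⟩ := hgrid e' (by simpa [l] using he')
        exact cellRel_of_grid hc φ φ'
      · refine (hu2 w fun j => ?_).trans (hcol a')
        simpa [hlasts] using hw j
  · intro x hx
    simp only [pieceSupp, List.mem_toFinset, List.mem_append, List.mem_flatMap, List.mem_ofFn,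
      List.mem_singleton] at hx
    rcases hx with ⟨e, he, j, rfl⟩ | rfl
    · obtain ⟨φ, rfl⟩ := hgrid e he
      exact mem_image.2 ⟨(j, φ j), mem_univ _, rfl⟩
    · exact mem_image.2 ⟨(0, a'), mem_univ _, rfl⟩
  · intro x hx
    obtain ⟨z, -, rfl⟩ := mem_image.1 hx
    simp only [pieceSupp, List.mem_toFinset, List.mem_append, List.mem_flatMap, List.mem_ofFn,
      List.mem_singleton]
    by_cases h1 : z = a'
    · exact Or.inr (by rw [h1])
    left
    by_cases h2 : z = y
    · exact ⟨last, by simp [l], 0, by rw [h2, hlast0]⟩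
    by_cases h3 : z = a
    · exact ⟨row a, by simp [l], 0, by rw [h3]⟩
    · exact ⟨row z, by simpa [l] using Or.inr (Or.inl ⟨z, (hzs z).2 ⟨h2, h1, h3⟩, rfl⟩), 0, rfl⟩

end Pieces

/-- A dense set of cells contains a grid of which all cells are edges of the same colour. -/
theorem exists_mono_grid (m K r : ℕ) (κ : ℝ) (hκ : 0 < κ) : ∃ N₁ : ℕ,
    ∀ (α : Type) [Fintype α] [DecidableEq α], N₁ ≤ Fintype.card α →
    ∀ (χ : Finset α → Fin r) (E : Finset (Fin (K + 1) → α)),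
    κ * (Fintype.card α : ℝ) ^ (K + 1) ≤ #E →
    ∃ (t : Fin (K + 1) → Fin m → α) (c : Fin r), Function.Injective (Function.uncurry t) ∧
      ∀ φ : Fin (K + 1) → Fin m,
        (fun j => t j (φ j)) ∈ E ∧ χ (univ.image fun j => t j (φ j)) = c := by
  rcases Nat.eq_zero_or_pos r with rfl | hr
  · exact ⟨0, fun α _ _ _ χ => (χ ∅).elim0⟩
  have hr' : (0 : ℝ) < r := by exact_mod_cast hr
  obtain ⟨N₁, hN₁⟩ := exists_blowup m (K + 1) (κ / (2 * r)) (by positivity)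
  obtain ⟨N₂, hN₂⟩ := exists_nat_ge (2 * ((K + 1 : ℕ) : ℝ) ^ 2 / κ)
  refine ⟨max N₁ (N₂ + 1), fun α _ _ hN χ E hE => ?_⟩
  have hNpos : 0 < Fintype.card α := by
    have := le_max_right N₁ (N₂ + 1)
    omega
  have hNR : (0 : ℝ) < Fintype.card α := by exact_mod_cast hNpos
  have h2N : 2 * ((K + 1 : ℕ) : ℝ) ^ 2 ≤ κ * Fintype.card α := by
    have h1 : N₂ ≤ Fintype.card α := by
      have := le_max_right N₁ (N₂ + 1)
      omega
    have h2 : (N₂ : ℝ) ≤ Fintype.card α := by exact_mod_cast h1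
    have := (div_le_iff₀ hκ).1 (hN₂.trans h2)
    linarith
  have hninj : (#{x : Fin (K + 1) → α | ¬ Function.Injective x} : ℝ) ≤
      κ / 2 * (Fintype.card α : ℝ) ^ (K + 1) := by
    have h1 := card_not_injective_mul_le (ι := Fin (K + 1)) (α := α)
    simp only [Fintype.card_fin, Fintype.card_pi, prod_const, card_univ] at h1
    have h2 : (#{x : Fin (K + 1) → α | ¬ Function.Injective x} : ℝ) * Fintype.card α ≤
        ((K + 1 : ℕ) : ℝ) ^ 2 * (Fintype.card α : ℝ) ^ (K + 1) := by exact_mod_cast h1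
    refine le_of_mul_le_mul_right (h2.trans ?_) hNR
    have h3 : (0 : ℝ) < (Fintype.card α : ℝ) ^ (K + 1) := by positivity
    nlinarith
  set E' := E.filter Function.Injective with hE'
  have hE'c : κ / 2 * (Fintype.card α : ℝ) ^ (K + 1) ≤ #E' := by
    have h1 : #E ≤ #E' + #{x : Fin (K + 1) → α | ¬ Function.Injective x} := by
      rw [← card_filter_add_card_filter_not (s := E) Function.Injective]
      exact Nat.add_le_add_left (card_le_card (filter_subset_filter _ (subset_univ _))) _
    have h2 : (#E : ℝ) ≤ #E' + #{x : Fin (K + 1) → α | ¬ Function.Injective x} := by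
      exact_mod_cast h1
    linarith
  obtain ⟨c, hc⟩ : ∃ c : Fin r, κ / (2 * r) * (Fintype.card α : ℝ) ^ (K + 1) ≤
      #{e ∈ E' | χ (univ.image e) = c} := by
    by_contra! hcon
    have h1 := card_eq_sum_card_fiberwise (f := fun e => χ (univ.image e)) (s := E') (t := univ)
      (fun _ _ => by simp)
    have h2 : (#E' : ℝ) < ∑ c : Fin r, κ / (2 * r) * (Fintype.card α : ℝ) ^ (K + 1) := by
      rw [h1, Nat.cast_sum]
      exact sum_lt_sum_of_nonempty ⟨⟨0, hr⟩, mem_univ _⟩ fun a _ => hcon a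
    simp only [sum_const, card_univ, Fintype.card_fin, nsmul_eq_mul] at h2
    have h3 : (r : ℝ) * (κ / (2 * r) * (Fintype.card α : ℝ) ^ (K + 1)) =
      κ / 2 * (Fintype.card α : ℝ) ^ (K + 1) := by field_simp
    linarith
  obtain ⟨t, ht, htE⟩ := hN₁ α ((le_max_left _ _).trans hN) _ hc
  simp only [hE', mem_filter] at htE
  refine ⟨t, c, ?_, fun φ => ⟨(htE φ).1.1, (htE φ).2⟩⟩
  rintro ⟨i, x⟩ ⟨j, y⟩ h
  simp only [Function.uncurry] at h
  by_cases hij : i = j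
  · subst hij
    rw [ht i h]
  · have h1 := (htE (Function.update (fun _ => x) j y)).1.2
    have h2 : i = j := by
      apply h1
      simpa [Function.update_of_ne hij] using h
    exact absurd h2 hij

/-- Between large sets `X` and `Y` there is a piece which can be linked through `R₀`. -/
theorem exists_piece (m K r : ℕ) (hm : 3 ≤ m) (hr : 0 < r) (d θ c₁ : ℝ) (hd : 0 < d)
    (hdm : 2 / d ≤ m) (hθ : 0 < θ) (hc₁ : c₁ = 2⁻¹ * ((r : ℝ)⁻¹) ^ 2 ^ K) : ∃ N₁ : ℕ,
    ∀ (α : Type) [Fintype α] [DecidableEq α], N₁ ≤ Fintype.card α →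
    ∀ (χ : Finset α → Fin r) (R R₀ : Finset α) (Bad : Finset (Fin (K + 1) → α)), R₀.Nonempty →
    d * (#R₀ : ℝ) ^ K ≤ 2⁻¹ * (c₁ * θ ^ K) * (Fintype.card α : ℝ) ^ K →
    (#Bad : ℝ) ≤ θ * (c₁ * θ ^ K) / 2 * (Fintype.card α : ℝ) ^ (K + 1) →
    (∀ e ∉ Bad, (#(mixNbr (edgeCol χ (e 0)) (fun j => e j.succ) ∩
        Fintype.piFinset fun _ => R) : ℝ) ≤
      #(mixNbr (edgeCol χ (e 0)) (fun j => e j.succ) ∩ Fintype.piFinset fun _ => R₀) +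
        2⁻¹ * (c₁ * θ ^ K) * (Fintype.card α : ℝ) ^ K) →
    ∀ X Y : Finset α, Disjoint X Y → Y ⊆ R → θ * Fintype.card α ≤ #X → θ * Fintype.card α ≤ #Y →
    ∃ (c : Fin r) (p : List (Fin (K + 1) → α) × α) (Z : Finset (Fin K → α)),
      IsPiece χ c Z p ∧ Z ⊆ Fintype.piFinset (fun _ => R₀) ∧
      d ^ 2 / 2 * (#R₀ : ℝ) ^ K ≤ #Z ∧ pieceSupp p ⊆ X ∪ Y ∧
      #(pieceSupp p ∩ Y) ≤ K * #(pieceSupp p ∩ X) ∧ m ≤ #(pieceSupp p ∩ X) := by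
  have hr' : (0 : ℝ) < r := by exact_mod_cast hr
  have hc0 : 0 < c₁ := by
    rw [hc₁]
    positivity
  obtain ⟨N₁, hN₁⟩ := exists_mono_grid m K r (θ * (c₁ * θ ^ K) / 2) (by positivity)
  refine ⟨max N₁ 1, fun α _ _ hN χ R R₀ Bad hR₀ hdP hBad hdev X Y hXY hYR hX hY => ?_⟩
  have hNR : (0 : ℝ) < Fintype.card α := by
    have := (le_max_right _ _).trans hN
    exact_mod_cast this
  have hYne : Y.Nonempty := by
    rw [← card_pos]
    have : (0 : ℝ) < #Y := lt_of_lt_of_le (by positivity) hY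
    exact_mod_cast this
  let good : α → Finset (Fin K → α) := fun v => {f ∈ Fintype.piFinset (fun _ : Fin K => Y) |
      c₁ * (#Y : ℝ) ^ K ≤ #(mixNbr (edgeCol χ v) f ∩ Fintype.piFinset fun _ => Y)}
  let E : Finset (Fin (K + 1) → α) := {e | e 0 ∈ X ∧ (fun j => e j.succ) ∈ good (e 0)}
  have hE : θ * (c₁ * θ ^ K) * (Fintype.card α : ℝ) ^ (K + 1) ≤ #E := by
    have h1 : ∑ v ∈ X, #(good v) ≤ #E := by
      rw [← card_sigma]
      refine card_le_card_of_injOn (fun p => Fin.cons p.1 p.2) ?_ ?_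
      · rintro ⟨v, f⟩ h
        simp only [coe_sigma, Set.mem_sigma_iff, mem_coe] at h
        simpa [E] using h
      · rintro ⟨v, f⟩ _ ⟨v', f'⟩ _ h
        obtain ⟨h2, h3⟩ := Fin.cons_injective2 h
        simp only at h2 h3
        subst h2 h3
        rfl
    calc θ * (c₁ * θ ^ K) * (Fintype.card α : ℝ) ^ (K + 1)
        = (θ * Fintype.card α) * (c₁ * (θ * Fintype.card α) ^ K) := by ring
      _ ≤ #X * (c₁ * (#Y : ℝ) ^ K) := by gcongr
      _ ≤ ∑ v ∈ X, (#(good v) : ℝ) := by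
        rw [← nsmul_eq_mul]
        exact card_nsmul_le_sum X (fun v => (#(good v) : ℝ)) _ fun v _ =>
          card_large_mixNbr Y hYne (edgeCol χ v) hr c₁ hc₁
      _ ≤ #E := by exact_mod_cast h1
  have hEB : θ * (c₁ * θ ^ K) / 2 * (Fintype.card α : ℝ) ^ (K + 1) ≤ #(E \ Bad) := by
    have h1 : (#E : ℝ) ≤ #(E \ Bad) + #Bad := by
      exact_mod_cast (card_le_card_sdiff_add_card)
    linarith
  obtain ⟨t, c, ht, htc⟩ := hN₁ α ((le_max_left _ _).trans hN) χ (E \ Bad) hEB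
  have htE : ∀ φ : Fin (K + 1) → Fin m, (fun j => t j (φ j)) ∈ E := fun φ =>
    (mem_sdiff.1 (htc φ).1).1
  have htX : ∀ z, t 0 z ∈ X := fun z => (mem_filter.1 (htE fun _ => z)).2.1
  have htY : ∀ j : Fin K, ∀ z, t j.succ z ∈ Y := fun j z => by
    have := (mem_filter.1 (htE fun _ => z)).2.2
    exact Fintype.mem_piFinset.1 (mem_filter.1 this).1 j
  have hWc : (#(Fintype.piFinset fun _ : Fin K => R₀) : ℝ) = (#R₀ : ℝ) ^ K := by
    rw [Fintype.card_piFinset_const, Nat.cast_pow]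
  obtain ⟨p, Z, hp, hZW, hZc, hsub, hsup⟩ := exists_piece_of_grid hm hd hdm ht
    (fun φ => (htc φ).2) (W := Fintype.piFinset fun _ : Fin K => R₀)
    (Fintype.piFinset_nonempty.2 fun _ => hR₀) (fun z => by
      have h1 := hdev _ (mem_sdiff.1 (htc fun _ => z).1).2
      have h2 := (mem_filter.1 (mem_filter.1 (htE fun _ => z)).2.2).2
      simp only at h1 h2
      have h3 : (#(mixNbr (edgeCol χ (t 0 z)) (fun j => t j.succ z) ∩
          Fintype.piFinset fun _ => Y) : ℝ) ≤ #(mixNbr (edgeCol χ (t 0 z)) (fun j => t j.succ z) ∩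
          Fintype.piFinset fun _ => R) := by
        exact_mod_cast card_le_card
          (inter_subset_inter_left (Fintype.piFinset_subset _ _ fun _ => hYR))
      have h4 : c₁ * θ ^ K * (Fintype.card α : ℝ) ^ K ≤ c₁ * (#Y : ℝ) ^ K := by
        rw [mul_assoc, ← mul_pow]
        gcongr
      rw [hWc]
      linarith)
  rw [hWc] at hZc
  have hXimg : univ.image (t 0) ⊆ pieceSupp p ∩ X := subset_inter hsup fun x hx => by
    obtain ⟨z, -, rfl⟩ := mem_image.1 hx
    exact htX z
  have hXc : m ≤ #(pieceSupp p ∩ X) := by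
    refine le_trans (le_of_eq ?_) (card_le_card hXimg)
    rw [card_image_of_injective, card_univ, Fintype.card_fin]
    intro x y h
    have := @ht (0, x) (0, y) h
    simpa using this
  refine ⟨c, p, Z, hp, hZW, hZc, fun x hx => ?_, ?_, hXc⟩
  · obtain ⟨⟨j, z⟩, -, rfl⟩ := mem_image.1 (hsub hx)
    refine Fin.cases ?_ (fun j => ?_) j
    · exact mem_union_left _ (htX z)
    · exact mem_union_right _ (htY j z)
  · refine le_trans (le_trans (card_le_card (t := univ.image
      fun x : Fin K × Fin m => t x.1.succ x.2) fun x hx => ?_) card_image_le) ?_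
    · obtain ⟨hx, hxY⟩ := mem_inter.1 hx
      obtain ⟨⟨j, z⟩, -, rfl⟩ := mem_image.1 (hsub hx)
      revert hxY
      refine Fin.cases (fun hxY => ?_) (fun j _ => ?_) j
      · exact absurd hxY (Finset.disjoint_left.1 hXY (htX z))
      · exact mem_image.2 ⟨(j, z), mem_univ _, rfl⟩
    · rw [card_univ, Fintype.card_prod, Fintype.card_fin, Fintype.card_fin]
      exact Nat.mul_le_mul_left _ hXc

theorem List.IsChain.rel_getElem_mod {γ : Type*} {R : γ → γ → Prop} {l : List γ}
    (hl : l.IsChain R) (hne : l ≠ []) (hclose : R (l.getLast hne) (l.head hne)) (a : ℕ) :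
    R (l[a % l.length]'(Nat.mod_lt _ (List.length_pos_iff.2 hne)))
      (l[(a + 1) % l.length]'(Nat.mod_lt _ (List.length_pos_iff.2 hne))) := by
  have hpos := List.length_pos_iff.2 hne
  have hlt := Nat.mod_lt a hpos
  by_cases h : a % l.length + 1 < l.length
  · have h1 : (a + 1) % l.length = a % l.length + 1 := by
      rw [Nat.add_mod, Nat.mod_eq_of_lt (a := 1) (by omega), Nat.mod_eq_of_lt h]
    simp only [h1]
    exact hl.getElem _ h
  · have h0 : a % l.length = l.length - 1 := by omega
    have h1 : (a + 1) % l.length = 0 := by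
      rw [← Nat.mod_add_mod, h0, Nat.sub_add_cancel hpos, Nat.mod_self]
    simp only [h0, h1]
    rw [List.getLast_eq_getElem, List.head_eq_getElem] at hclose
    exact hclose

section Cycles

variable {α β : Type*} {K : ℕ}

/-- The sequence of vertices obtained by concatenating a sequence of cells. -/
def cellSeq (E : ℕ → Fin (K + 1) → α) (x : ℕ) : α :=
  E (x / (K + 1)) ⟨x % (K + 1), Nat.mod_lt _ K.succ_pos⟩

theorem cellSeq_mul_add (E : ℕ → Fin (K + 1) → α) (a : ℕ) (i : Fin (K + 1)) :
    cellSeq E ((K + 1) * a + i) = E a i := by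
  have h1 : ((K + 1) * a + i) / (K + 1) = a := by
    rw [Nat.mul_add_div K.succ_pos, Nat.div_eq_of_lt i.2, add_zero]
  have h2 : ((K + 1) * a + i) % (K + 1) = i := by
    rw [Nat.mul_add_mod, Nat.mod_eq_of_lt i.2]
  simp only [cellSeq, h1, h2]

variable [DecidableEq α]

theorem cellSeq_window {χ : Finset α → β} {c : β} {E : ℕ → Fin (K + 1) → α}
    (hE : ∀ a, CellRel χ c (E a) (E (a + 1))) (x : ℕ) :
    χ ((range (K + 1)).image fun j => cellSeq E (x + 1 + j)) = c := by
  set a := x / (K + 1) with ha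
  set o := x % (K + 1) with ho
  have hoK : o < K + 1 := Nat.mod_lt _ K.succ_pos
  have hx : x = (K + 1) * a + o := (Nat.div_add_mod x (K + 1)).symm
  rw [← hE a (fun j => if (j : ℕ) < o then E (a + 1) j.succ else E a j.succ) fun j => by
    by_cases h : (j : ℕ) < o <;> simp [h]]
  unfold edgeCol
  congr 1
  have hleft : ∀ i : Fin (K + 1), cellSeq E ((K + 1) * a + i) = E a i := cellSeq_mul_add E a
  have hright : ∀ i : Fin (K + 1), cellSeq E ((K + 1) * a + (K + 1) + i) = E (a + 1) i :=
    fun i => by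
      rw [← cellSeq_mul_add E (a + 1) i, mul_add, mul_one]
  ext v
  simp only [mem_insert, mem_image, mem_univ, true_and, mem_range]
  constructor
  · rintro ⟨j, hj, rfl⟩
    by_cases h : o + 1 + j < K + 1
    · right
      refine ⟨⟨o + j, by omega⟩, ?_⟩
      rw [if_neg (by simp), ← hleft]
      congr 1
      simp only [Fin.val_succ]
      omega
    · by_cases h0 : o + 1 + j = K + 1
      · left
        rw [← hright]
        congr 1
        simp only [Fin.val_zero]
        omega
      · right
        refine ⟨⟨o + j - (K + 1), by omega⟩, ?_⟩
        rw [if_pos (by simp only; omega), ← hright]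
        congr 1
        simp only [Fin.val_succ]
        omega
  · rintro (rfl | ⟨i, rfl⟩)
    · refine ⟨K - o, by omega, ?_⟩
      rw [← hright]
      congr 1
      simp only [Fin.val_zero]
      omega
    · have := i.2
      split_ifs with h
      · refine ⟨i + K + 1 - o, by omega, ?_⟩
        rw [← hright]
        congr 1
        simp only [Fin.val_succ]
        omega
      · refine ⟨i - o, by omega, ?_⟩
        rw [← hleft]
        congr 1
        simp only [Fin.val_succ]
        omega

/-- A cyclic sequence of cells gives a monochromatic tight cycle. -/
theorem exists_cyclic_ordering {χ : Finset α → β} {c : β} {l : List (Fin (K + 1) → α)}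
    (hl : l.IsChain (CellRel χ c)) (hne : l ≠ [])
    (hclose : CellRel χ c (l.getLast hne) (l.head hne))
    (hnodup : (l.flatMap List.ofFn).Nodup) (C : Finset α)
    (hC : C = (l.flatMap List.ofFn).toFinset) :
    ∃ g : ℕ → α, (∀ i, g (i + #C) = g i) ∧ Set.InjOn g (Set.Iio #C) ∧
      (range #C).image g = C ∧ ∀ i, χ ((range (K + 1)).image fun j => g (i + j)) = c := by
  have hpos := List.length_pos_iff.2 hne
  have hcard : #C = (K + 1) * l.length := by
    rw [hC, List.toFinset_card_of_nodup hnodup]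
    simp [List.length_flatMap, mul_comm]
  let E : ℕ → Fin (K + 1) → α := fun a => l[a % l.length]'(Nat.mod_lt _ hpos)
  have hE : ∀ a, CellRel χ c (E a) (E (a + 1)) := hl.rel_getElem_mod hne hclose
  have hEper : ∀ a, E (a + l.length) = E a := fun a => by
    have h : (a + l.length) % l.length = a % l.length := Nat.add_mod_right _ _
    simp only [E, h]
  have hper : ∀ i, cellSeq E (i + #C) = cellSeq E i := by
    intro i
    simp only [cellSeq, hcard, Nat.add_mul_div_left _ _ K.succ_pos, Nat.add_mul_mod_self_left,
      hEper]
  have himg : (range #C).image (cellSeq E) = C := by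
    ext v
    rw [hC, mem_image, List.mem_toFinset, List.mem_flatMap]
    constructor
    · rintro ⟨x, -, rfl⟩
      exact ⟨E (x / (K + 1)), List.getElem_mem _, List.mem_ofFn.2 ⟨_, rfl⟩⟩
    · rintro ⟨e, he, hv⟩
      obtain ⟨i, rfl⟩ := List.mem_ofFn.1 hv
      obtain ⟨a, ha, rfl⟩ := List.getElem_of_mem he
      refine ⟨(K + 1) * a + i, ?_, ?_⟩
      · rw [mem_range, ← hC, hcard]
        have := i.2
        nlinarith
      · rw [cellSeq_mul_add]
        have h : a % l.length = a := Nat.mod_eq_of_lt ha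
        have h' : E a = l[a] := by simp only [E, h]
        rw [h']
  refine ⟨cellSeq E, hper, ?_, himg, fun i => ?_⟩
  · have : #((range #C).image (cellSeq E)) = #(range #C) := by rw [himg, card_range]
    have := card_image_iff.1 this
    rwa [coe_range] at this
  · have h := cellSeq_window hE (i + #C - 1)
    have hCpos : 0 < #C := by
      rw [hcard]
      positivity
    rw [Nat.sub_add_cancel (by omega)] at h
    rw [← h]
    congr 2
    ext j
    rw [← hper (i + j)]
    congr 1
    omega

end Cycles

section CyclicPartition

variable {τ γ : Type*}

theorem List.exists_append_of_last (p : τ → Prop) (l : List τ) :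
    ∃ l₁ l₂, l = l₁ ++ l₂ ∧ (∀ a ∈ l₁.getLast?, p a) ∧ ∀ y ∈ l₂, ¬ p y := by
  induction l using List.reverseRecOn with
  | nil => exact ⟨[], [], by simp⟩
  | append_singleton l a ih =>
    by_cases ha : p a
    · exact ⟨l ++ [a], [], by simp [ha]⟩
    · obtain ⟨l₁, l₂, rfl, h₁, h₂⟩ := ih
      refine ⟨l₁, l₂ ++ [a], by simp, h₁, fun y hy => ?_⟩
      rcases List.mem_append.1 hy with hy | hy
      · exact h₂ y hy
      · rw [List.mem_singleton.1 hy]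
        exact ha

/-- A list that is traversed cyclically by the map `f`. -/
def List.IsCyclicFor (f : τ → τ) (l : List τ) : Prop :=
  l.IsChain (fun a b => f a = b) ∧ ∀ a ∈ l.getLast?, ∀ b ∈ l.head?, f a = b

theorem List.exists_isCyclicFor [DecidableEq τ] {R : τ → τ → Prop} {l : List τ}
    (hne : l ≠ []) (hnd : l.Nodup)
    (hl : l.IsChain R) (hclose : R (l.getLast hne) (l.head hne)) :
    ∃ f : τ → τ, l.IsCyclicFor f ∧ ∀ x ∈ l, f x ∈ l ∧ R x (f x) := by
  have hpos := List.length_pos_iff.2 hne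
  have hlt : ∀ a, a % l.length < l.length := fun a => Nat.mod_lt _ hpos
  let f : τ → τ := fun x => l[(l.idxOf x + 1) % l.length]'(hlt _)
  have hf : ∀ i (hi : i < l.length), f l[i] = l[(i + 1) % l.length]'(hlt _) := fun i hi => by
    have : l.idxOf l[i] = i := hnd.idxOf_getElem i hi
    simp only [f, this]
  refine ⟨f, ⟨?_, ?_⟩, ?_⟩
  · rw [List.isChain_iff_getElem]
    intro i hi
    have h : (i + 1) % l.length = i + 1 := Nat.mod_eq_of_lt hi
    rw [hf i (by omega)]
    simp only [h]
  · intro a ha b hb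
    rw [List.getLast?_eq_some_getLast hne, Option.mem_some_iff] at ha
    rw [List.head?_eq_some_head hne, Option.mem_some_iff] at hb
    rw [← ha, ← hb, List.getLast_eq_getElem, List.head_eq_getElem, hf]
    have h : (l.length - 1 + 1) % l.length = 0 := by
      rw [Nat.sub_add_cancel hpos, Nat.mod_self]
    simp only [h]
  · intro x hx
    obtain ⟨i, hi, rfl⟩ := List.getElem_of_mem hx
    refine ⟨List.getElem_mem _, ?_⟩
    rw [hf i hi]
    have h := hl.rel_getElem_mod hne hclose i
    have h' : i % l.length = i := Nat.mod_eq_of_lt hi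
    simp only [h'] at h
    exact h

theorem List.IsCyclicFor.congr {f g : τ → τ} {l : List τ} (h : l.IsCyclicFor f)
    (hfg : ∀ x ∈ l, f x = g x) : l.IsCyclicFor g := by
  refine ⟨?_, fun a ha b hb => ?_⟩
  · have := h.1
    rw [List.isChain_iff_getElem] at this ⊢
    intro i hi
    rw [← hfg _ (List.getElem_mem _)]
    exact this i hi
  · rw [← hfg a (List.mem_of_getLast? ha)]
    exact h.2 a ha b hb

/-- A finite set with a reflexive symmetric relation can be partitioned into cyclically ordered
lists, at most as many as the largest size of an independent set. -/
theorem exists_cyclic_partition [DecidableEq τ] {R : τ → τ → Prop} (hrefl : ∀ x, R x x)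
    (hsymm : ∀ x y, R x y → R y x) (S : Finset τ) :
    ∃ (f : τ → τ) (𝓛 : List (List τ)) (I : Finset τ),
      (∀ x ∈ S, f x ∈ S ∧ R x (f x)) ∧ 𝓛.flatten.Nodup ∧ 𝓛.flatten.toFinset = S ∧
      (∀ l ∈ 𝓛, l ≠ [] ∧ l.IsCyclicFor f) ∧
      I ⊆ S ∧ #I = 𝓛.length ∧ ∀ x ∈ I, ∀ y ∈ I, R x y → x = y := by
  induction S using Finset.strongInduction with
  | H S ih =>
  rcases S.eq_empty_or_nonempty with rfl | ⟨x₀, hx₀⟩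
  · exact ⟨id, [], ∅, by simp⟩
  obtain ⟨l, ⟨hnd, hlS, hlc⟩, hmax⟩ := exists_minimalFor_of_wellFoundedLT
    (fun l : List τ => l.Nodup ∧ (∀ y ∈ l, y ∈ S) ∧ l.IsChain R)
    (fun l => #S - l.length) ⟨[], by simp⟩
  have hlen : ∀ l : List τ, l.Nodup → (∀ y ∈ l, y ∈ S) → l.length ≤ #S := fun l h1 h2 => by
    rw [← List.toFinset_card_of_nodup h1]
    exact card_le_card fun y hy => h2 y (List.mem_toFinset.1 hy)
  have hext : ∀ y ∈ S, y ∉ l → ¬ (y :: l).IsChain R := fun y hy hyl hc => by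
    have hnd' : (y :: l).Nodup := List.nodup_cons.2 ⟨hyl, hnd⟩
    have hS' : ∀ z ∈ y :: l, z ∈ S := fun z hz => by
      rcases List.mem_cons.1 hz with rfl | hz
      exacts [hy, hlS z hz]
    have h1 := hmax ⟨hnd', hS', hc⟩ (by simp; omega)
    have h2 := hlen _ hnd' hS'
    simp only [List.length_cons] at h1 h2
    omega
  obtain _ | ⟨x, t⟩ := l
  · exact absurd (List.isChain_singleton x₀) (hext x₀ hx₀ (by simp))
  have hxS : x ∈ S := hlS x (by simp)
  have hnbr : ∀ y ∈ S, R y x → y ∈ x :: t := fun y hy hyx => by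
    by_contra hyl
    exact hext y hy hyl (List.isChain_cons_cons.2 ⟨hyx, hlc⟩)
  obtain ⟨l₁, l₂, hl, hl₁, hl₂⟩ := List.exists_append_of_last (fun y => R y x) (x :: t)
  rw [hl] at hnd hlc hlS hnbr
  have hx₁ : x ∈ l₁ := by
    have : x ∈ l₁ ++ l₂ := hl ▸ List.mem_cons_self
    exact (List.mem_append.1 this).resolve_right fun h => hl₂ x h (hrefl x)
  have hne : l₁ ≠ [] := List.ne_nil_of_mem hx₁
  have hhead : l₁.head hne = x := by
    have h1 : (l₁ ++ l₂).head? = some x := by rw [← hl, List.head?_cons]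
    rw [List.head?_append_of_ne_nil _ hne, List.head?_eq_some_head hne] at h1
    exact Option.some_injective _ h1
  have hclose : R (l₁.getLast hne) (l₁.head hne) := by
    rw [hhead]
    exact hl₁ _ (List.getLast?_eq_some_getLast hne)
  obtain ⟨f₁, hcyc, hf₁⟩ := List.exists_isCyclicFor hne hnd.of_append_left
    (List.isChain_append.1 hlc).1 hclose
  have hl₁S : l₁.toFinset ⊆ S := fun y hy =>
    hlS y (List.mem_append_left _ (List.mem_toFinset.1 hy))
  obtain ⟨f', 𝓛, I, hf', hnd', hS', h𝓛, hI, hcard, hind⟩ := ih (S \ l₁.toFinset)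
    (sdiff_ssubset hl₁S ⟨x, List.mem_toFinset.2 hx₁⟩)
  have hmem : ∀ l ∈ 𝓛, ∀ y ∈ l, y ∈ S ∧ y ∉ l₁ := fun l hl y hy => by
    have : y ∈ 𝓛.flatten.toFinset := List.mem_toFinset.2 (List.mem_flatten.2 ⟨l, hl, hy⟩)
    rw [hS', mem_sdiff, List.mem_toFinset] at this
    exact this
  have hnotR : ∀ y ∈ I, ¬ R y x := fun y hy hyx => by
    have h1 := mem_sdiff.1 (hI hy)
    rw [List.mem_toFinset] at h1
    exact hl₂ y ((List.mem_append.1 (hnbr y h1.1 hyx)).resolve_left h1.2) hyx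
  refine ⟨fun y => if y ∈ l₁ then f₁ y else f' y, l₁ :: 𝓛, insert x I, ?_, ?_, ?_, ?_, ?_, ?_, ?_⟩
  · intro y hy
    by_cases h : y ∈ l₁
    · simp only [if_pos h]
      exact ⟨hl₁S (List.mem_toFinset.2 (hf₁ y h).1), (hf₁ y h).2⟩
    · simp only [if_neg h]
      have := hf' y (mem_sdiff.2 ⟨hy, by simpa using h⟩)
      exact ⟨(mem_sdiff.1 this.1).1, this.2⟩
  · rw [List.flatten_cons, List.nodup_append']
    refine ⟨hnd.of_append_left, hnd', fun y hy hy' => ?_⟩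
    obtain ⟨l, hl, hyl⟩ := List.mem_flatten.1 hy'
    exact (hmem l hl y hyl).2 hy
  · rw [List.flatten_cons, List.toFinset_append, hS', union_sdiff_of_subset hl₁S]
  · intro l hl
    rcases List.mem_cons.1 hl with rfl | hl
    · exact ⟨hne, hcyc.congr fun y hy => by rw [if_pos hy]⟩
    · exact ⟨(h𝓛 l hl).1, (h𝓛 l hl).2.congr fun y hy => by rw [if_neg (hmem l hl y hy).2]⟩
  · exact insert_subset hxS (hI.trans sdiff_subset)
  · rw [card_insert_of_notMem fun h => hnotR x h (hrefl x), hcard, List.length_cons]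
  · intro y hy z hz hyz
    rcases mem_insert.1 hy with hy' | hy' <;> rcases mem_insert.1 hz with hz' | hz'
    · rw [hy', hz']
    · exact absurd (hsymm _ _ (hy' ▸ hyz)) (hnotR z hz')
    · exact absurd (hz' ▸ hyz) (hnotR y hy')
    · exact hind y hy' z hz' hyz

theorem List.IsCyclicFor.isChain_flatMap {R : γ → γ → Prop} {f : τ → τ} (b : τ → List γ)
    (e : τ → γ) {l : List τ} (hl : l.IsCyclicFor f) (hne : l ≠ [])
    (h : ∀ x ∈ l, (e x :: (b (f x) ++ [e (f x)])).IsChain R) :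
    ∃ hne' : l.flatMap (fun x => b x ++ [e x]) ≠ [],
      (l.flatMap fun x => b x ++ [e x]).IsChain R ∧
      R ((l.flatMap fun x => b x ++ [e x]).getLast hne')
        ((l.flatMap fun x => b x ++ [e x]).head hne') := by
  have key : ∀ (t : List τ) (x : τ), (x :: t).IsChain (fun a b => f a = b) →
      (∀ y ∈ x :: t, (e y :: (b (f y) ++ [e (f y)])).IsChain R) →
      (e x :: t.flatMap fun x => b x ++ [e x]).IsChain R := by
    intro t
    induction t with
    | nil => simp
    | cons y t ih =>
      intro x hx hR
      rw [List.isChain_cons_cons] at hx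
      have h1 := hR x (by simp)
      have h2 := ih y hx.2 fun z hz => hR z (List.mem_cons_of_mem _ hz)
      rw [hx.1] at h1
      rw [List.flatMap_cons, List.append_assoc, List.singleton_append, ← List.cons_append,
        List.isChain_split]
      exact ⟨by simpa using h1, h2⟩
  have hne' : l.flatMap (fun x => b x ++ [e x]) ≠ [] := by
    obtain ⟨x, hx⟩ := List.exists_mem_of_ne_nil l hne
    refine List.ne_nil_of_mem (a := e x) (List.mem_flatMap.2 ⟨x, hx, by simp⟩)
  have hlast : (l.flatMap fun x => b x ++ [e x]).getLast hne' = e (l.getLast hne) := by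
    have : l.dropLast ++ [l.getLast hne] = l := List.dropLast_append_getLast hne
    have h2 : (l.flatMap fun x => b x ++ [e x]) =
        (l.dropLast.flatMap fun x => b x ++ [e x]) ++ b (l.getLast hne) ++ [e (l.getLast hne)] := by
      conv_lhs => rw [← this]
      simp [List.flatMap_append]
    simp only [h2, List.getLast_append_singleton]
  have hk := key l (l.getLast hne) ?_ ?_
  · refine ⟨hne', hk.tail, ?_⟩
    rw [hlast]
    obtain ⟨a, t, hat⟩ := List.exists_cons_of_ne_nil hne'
    simp only [hat, List.head_cons]
    rw [hat] at hk
    exact (List.isChain_cons_cons.1 hk).1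
  · rw [List.isChain_cons]
    exact ⟨fun y hy => hl.2 _ (List.getLast?_eq_some_getLast hne) y hy, hl.1⟩
  · intro y hy
    rcases List.mem_cons.1 hy with rfl | hy
    exacts [h _ (List.getLast_mem hne), h y hy]

end CyclicPartition

section Packing

variable {α : Type*} [Fintype α] [DecidableEq α]

theorem exists_maximal_packing {P Q : Finset α → Prop} (hQ : Q ∅) :
    ∃ 𝒬 : Finset (Finset α), (∀ S ∈ 𝒬, P S) ∧ (𝒬 : Set (Finset α)).PairwiseDisjoint id ∧
      Q (𝒬.biUnion id) ∧
      ∀ S, P S → S.Nonempty → Disjoint S (𝒬.biUnion id) → ¬ Q (S ∪ 𝒬.biUnion id) := by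
  obtain ⟨𝒬, ⟨h1, h2, h3⟩, hmax⟩ := (Set.toFinite {𝒬 : Finset (Finset α) | (∀ S ∈ 𝒬, P S) ∧
    (𝒬 : Set (Finset α)).PairwiseDisjoint id ∧ Q (𝒬.biUnion id)}).exists_maximalFor
    (fun 𝒬 => #(𝒬.biUnion id)) _ ⟨∅, by simpa using hQ⟩
  refine ⟨𝒬, h1, h2, h3, fun S hS hne hdis hQS => ?_⟩
  have hU : (insert S 𝒬).biUnion id = S ∪ 𝒬.biUnion id := by rw [biUnion_insert, id]
  have hmem : insert S 𝒬 ∈ {𝒬 : Finset (Finset α) | (∀ S ∈ 𝒬, P S) ∧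
      (𝒬 : Set (Finset α)).PairwiseDisjoint id ∧ Q (𝒬.biUnion id)} := by
    refine ⟨fun S' hS' => ?_, ?_, hU ▸ hQS⟩
    · rcases mem_insert.1 hS' with rfl | h
      exacts [hS, h1 _ h]
    · rw [coe_insert]
      refine h2.insert fun S' hS' _ => ?_
      exact hdis.mono_right (subset_biUnion_of_mem id hS')
  have h := hmax hmem (by
    simp only [hU]
    exact card_le_card subset_union_right)
  simp only [hU] at h
  rw [card_union_of_disjoint hdis] at h
  have := hne.card_pos
  omega

theorem exists_packing_of_disjoint {P : Finset α → Prop} {K : ℕ} {T : ℝ} {L R : Finset α}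
    (H : ∀ X Y : Finset α, Disjoint X Y → Y ⊆ R → T ≤ #X → T ≤ #Y →
      ∃ S, P S ∧ S ⊆ X ∪ Y ∧ #(S ∩ Y) ≤ K * #(S ∩ X) ∧ 0 < #(S ∩ X))
    (hLR : Disjoint L R) (hcard : K * #L + T ≤ #R) :
    ∃ 𝒬 : Finset (Finset α), (∀ S ∈ 𝒬, P S) ∧ (𝒬 : Set (Finset α)).PairwiseDisjoint id ∧
      𝒬.biUnion id ⊆ L ∪ R ∧ (#((L ∪ R) \ 𝒬.biUnion id) : ℝ) ≤ 3 * T + 1 := by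
  have hne : ∀ {S X : Finset α}, 0 < #(S ∩ X) → S.Nonempty := fun h =>
    (card_pos.1 h).mono inter_subset_left
  obtain ⟨𝒬₁, hP₁, hd₁, ⟨hU₁, hUK₁⟩, hmax₁⟩ := exists_maximal_packing (P := P)
    (Q := fun U => U ⊆ L ∪ R ∧ #(U ∩ R) ≤ K * #(U ∩ L)) (by simp)
  set U₁ := 𝒬₁.biUnion id with hU₁def
  obtain ⟨𝒬₂, hP₂, hd₂, hU₂, hmax₂⟩ := exists_maximal_packing (P := P)
    (Q := fun U => U ⊆ R \ U₁) (by simp)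
  set U₂ := 𝒬₂.biUnion id with hU₂def
  have hleft : (#(L \ U₁) : ℝ) < T := by
    by_contra! hL
    have hR : T ≤ #(R \ U₁) := by
      have h1 : #(R \ U₁) + #(U₁ ∩ R) = #R := by
        rw [inter_comm]
        exact card_sdiff_add_card_inter R U₁
      have h2 : #(U₁ ∩ R) ≤ K * #L :=
        hUK₁.trans (Nat.mul_le_mul_left _ (card_le_card inter_subset_right))
      have h3 : (#(R \ U₁) : ℝ) + #(U₁ ∩ R) = #R := mod_cast h1
      have h4 : (#(U₁ ∩ R) : ℝ) ≤ K * #L := mod_cast h2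
      linarith
    obtain ⟨S, hS, hSU, hSK, hSpos⟩ := H (L \ U₁) (R \ U₁)
      (hLR.mono sdiff_subset sdiff_subset) sdiff_subset hL hR
    have hdis : Disjoint S U₁ := by
      refine disjoint_left.2 fun v hv hv' => ?_
      rcases mem_union.1 (hSU hv) with h | h
      exacts [(mem_sdiff.1 h).2 hv', (mem_sdiff.1 h).2 hv']
    refine hmax₁ S hS (hne hSpos) hdis ⟨union_subset (hSU.trans ?_) hU₁, ?_⟩
    · exact union_subset_union sdiff_subset sdiff_subset
    · have hX : ∀ X : Finset α, S ∩ (X \ U₁) = S ∩ X := fun X => by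
        rw [← inter_sdiff_assoc, Finset.sdiff_eq_self_iff_disjoint]
        exact hdis.mono_left inter_subset_left
      rw [hX, hX] at hSK
      have hcu : ∀ X : Finset α, #((S ∪ U₁) ∩ X) = #(S ∩ X) + #(U₁ ∩ X) := fun X => by
        rw [union_inter_distrib_right, card_union_of_disjoint]
        exact hdis.mono inter_subset_left inter_subset_left
      rw [hcu, hcu, mul_add]
      exact add_le_add hSK hUK₁
  have hright : (#((R \ U₁) \ U₂) : ℝ) ≤ 2 * T + 1 := by
    by_contra! hW
    set W := (R \ U₁) \ U₂ with hWdef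
    obtain ⟨X, hXW, hXcard⟩ := exists_subset_card_eq (show #W / 2 ≤ #W by omega)
    have h1 : #(W \ X) + #X = #W := card_sdiff_add_card_eq_card hXW
    have h2 : (#W : ℝ) ≤ 2 * #X + 1 := by
      have : #W ≤ 2 * #X + 1 := by omega
      exact_mod_cast this
    have h3 : (#W : ℝ) ≤ 2 * #(W \ X) := by
      have : #W ≤ 2 * #(W \ X) := by omega
      exact_mod_cast this
    have hWR : W ⊆ R := sdiff_subset.trans sdiff_subset
    obtain ⟨S, hS, hSU, -, hSpos⟩ := H X (W \ X) disjoint_sdiff (sdiff_subset.trans hWR)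
      (by linarith) (by linarith)
    rw [union_sdiff_of_subset hXW] at hSU
    refine hmax₂ S hS (hne hSpos) ?_ (union_subset (hSU.trans sdiff_subset) hU₂)
    exact (disjoint_sdiff.symm : Disjoint W U₂).mono_left hSU
  have hdisU : Disjoint U₁ U₂ := (disjoint_sdiff : Disjoint U₁ (R \ U₁)).mono_right hU₂
  have hU : (𝒬₁ ∪ 𝒬₂).biUnion id = U₁ ∪ U₂ := union_biUnion
  refine ⟨𝒬₁ ∪ 𝒬₂, fun S hS => ?_, ?_, ?_, ?_⟩
  · rcases mem_union.1 hS with h | h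
    exacts [hP₁ S h, hP₂ S h]
  · rw [coe_union, Set.pairwiseDisjoint_union]
    refine ⟨hd₁, hd₂, fun S hS S' hS' _ => hdisU.mono ?_ ?_⟩
    exacts [subset_biUnion_of_mem id hS, subset_biUnion_of_mem id hS']
  · rw [hU]
    exact union_subset hU₁ ((hU₂.trans sdiff_subset).trans subset_union_right)
  · have hsub : (L ∪ R) \ (U₁ ∪ U₂) ⊆ (L \ U₁) ∪ ((R \ U₁) \ U₂) := by
      intro v
      simp only [mem_sdiff, mem_union]
      tauto
    have h1 := (card_le_card hsub).trans (card_union_le _ _)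
    have h2 : (#((L ∪ R) \ (U₁ ∪ U₂)) : ℝ) ≤ #(L \ U₁) + #((R \ U₁) \ U₂) := mod_cast h1
    rw [hU]
    linarith

theorem exists_packing_of_labelling {σ : Type*} [Fintype σ] [DecidableEq σ] {P : Finset α → Prop}
    {K : ℕ} {T : ℝ} (hT : 0 ≤ T) (h : α → σ) (s₀ : σ)
    (H : ∀ s ≠ s₀, ∀ X Y : Finset α, Disjoint X Y → Y ⊆ ({v | h v = s} : Finset α) →
      T ≤ #X → T ≤ #Y →
      ∃ S, P S ∧ S ⊆ X ∪ Y ∧ #(S ∩ Y) ≤ K * #(S ∩ X) ∧ 0 < #(S ∩ X))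
    (hcard : ∀ s ≠ s₀, K * (3 * T + 1) + T ≤ #{v | h v = s}) :
    ∃ 𝒬 : Finset (Finset α), (∀ S ∈ 𝒬, P S) ∧ (𝒬 : Set (Finset α)).PairwiseDisjoint id ∧
      (∀ v ∈ 𝒬.biUnion id, h v ≠ s₀) ∧
      (#(({v | h v ≠ s₀} : Finset α) \ 𝒬.biUnion id) : ℝ) ≤ 3 * T + 1 := by
  have key : ∀ A : Finset σ, s₀ ∉ A → ∃ 𝒬 : Finset (Finset α), (∀ S ∈ 𝒬, P S) ∧
      (𝒬 : Set (Finset α)).PairwiseDisjoint id ∧ (∀ v ∈ 𝒬.biUnion id, h v ∈ A) ∧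
      (#(({v | h v ∈ A} : Finset α) \ 𝒬.biUnion id) : ℝ) ≤ 3 * T + 1 := by
    intro A
    induction A using Finset.induction_on with
    | empty =>
      intro _
      refine ⟨∅, by simp, by simp, by simp, ?_⟩
      simp
      positivity
    | insert a A ha ih =>
      intro hs₀
      rw [mem_insert, not_or] at hs₀
      obtain ⟨𝒬₁, hP₁, hd₁, hU₁, hc₁⟩ := ih hs₀.2
      set U₁ := 𝒬₁.biUnion id with hU₁def
      set L := ({v | h v ∈ A} : Finset α) \ U₁ with hL
      set R : Finset α := {v | h v = a} with hR
      have hLR : Disjoint L R := by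
        refine disjoint_left.2 fun v hv hv' => ha ?_
        rw [hL, mem_sdiff, mem_filter_univ] at hv
        rw [hR, mem_filter_univ] at hv'
        exact hv' ▸ hv.1
      have hUR : Disjoint U₁ (L ∪ R) := by
        rw [disjoint_union_right]
        refine ⟨disjoint_sdiff, disjoint_left.2 fun v hv hv' => ha ?_⟩
        rw [hR, mem_filter_univ] at hv'
        exact hv' ▸ hU₁ v hv
      obtain ⟨𝒬₂, hP₂, hd₂, hU₂, hc₂⟩ := exists_packing_of_disjoint (H a (Ne.symm hs₀.1)) hLR
        ((add_le_add_left (mul_le_mul_of_nonneg_left hc₁ K.cast_nonneg) T).trans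
          (hcard a (Ne.symm hs₀.1)))
      set U₂ := 𝒬₂.biUnion id with hU₂def
      have hU : (𝒬₁ ∪ 𝒬₂).biUnion id = U₁ ∪ U₂ := union_biUnion
      refine ⟨𝒬₁ ∪ 𝒬₂, fun S hS => ?_, ?_, ?_, ?_⟩
      · rcases mem_union.1 hS with h | h
        exacts [hP₁ S h, hP₂ S h]
      · rw [coe_union, Set.pairwiseDisjoint_union]
        refine ⟨hd₁, hd₂, fun S hS S' hS' _ => (hUR.mono_right hU₂).mono ?_ ?_⟩
        exacts [subset_biUnion_of_mem id hS, subset_biUnion_of_mem id hS']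
      · rw [hU]
        intro v hv
        rcases mem_union.1 hv with hv | hv
        · exact mem_insert_of_mem (hU₁ v hv)
        · have := hU₂ hv
          simp only [hL, mem_union, mem_sdiff, mem_filter_univ] at this
          rw [mem_insert]
          tauto
      · refine le_trans (Nat.cast_le.2 (card_le_card fun v hv => ?_)) hc₂
        rw [hU] at hv
        simp only [hL, mem_union, mem_sdiff, mem_filter_univ, mem_insert] at hv ⊢
        tauto
  obtain ⟨𝒬, h1, h2, h3, h4⟩ := key (univ.erase s₀) (by simp)
  refine ⟨𝒬, h1, h2, fun v hv => ?_, ?_⟩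
  · simpa using h3 v hv
  · simpa using h4

theorem exists_disjoint_links [Nonempty α] {τ : Type*} {K : ℕ} (S : Finset τ)
    (G : τ → Finset (Fin K → α)) (M : ℕ) (hM : #S ≤ M)
    (hG : ∀ x ∈ S, K ^ 2 * (M + 1) * Fintype.card (Fin K → α) < #(G x) * Fintype.card α) :
    ∃ u : τ → Fin K → α, (∀ x ∈ S, u x ∈ G x ∧ Function.Injective (u x)) ∧
      ∀ x ∈ S, ∀ y ∈ S, x ≠ y → ∀ i j, u x i ≠ u y j := by
  classical
  induction S using Finset.induction_on with
  | empty => exact ⟨fun _ _ => Classical.arbitrary α, by simp, by simp⟩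
  | insert a S ha ih =>
    rw [card_insert_of_notMem ha] at hM
    obtain ⟨u, hu, hdis⟩ := ih (by omega) fun x hx => hG x (mem_insert_of_mem hx)
    set Q := S.biUnion fun x => univ.image (u x) with hQ
    have hQcard : #Q ≤ K * #S := by
      rw [mul_comm]
      refine card_biUnion_le_card_mul _ _ _ fun x _ => card_image_le.trans (by simp)
    have h1 := card_not_injective_mul_le (ι := Fin K) (α := α)
    have h2 := card_meets_mul_le (ι := Fin K) Q
    obtain ⟨f, hfG, hf⟩ : ∃ f ∈ G a, f ∉ ({x : Fin K → α | ¬ Function.Injective x} : Finset _) ∪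
        ({x : Fin K → α | ∃ i, x i ∈ Q} : Finset _) := by
      by_contra! hsub
      have h3 := (card_le_card hsub).trans (card_union_le _ _)
      have h4 := hG a (mem_insert_self _ _)
      have h5 := Nat.mul_le_mul_right (Fintype.card α) h3
      rw [add_mul] at h5
      have h6 : #({x : Fin K → α | ∃ i, x i ∈ Q} : Finset _) * Fintype.card α ≤
          K * (#Q * Fintype.card (Fin K → α)) := by convert h2; simp
      have h7 : K * (#Q * Fintype.card (Fin K → α)) ≤
          K * ((K * M) * Fintype.card (Fin K → α)) := by
        gcongr
        exact hQcard.trans (Nat.mul_le_mul_left _ (by omega))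
      rw [Fintype.card_fin] at h1
      have h8 : K ^ 2 * (M + 1) * Fintype.card (Fin K → α) =
          K ^ 2 * Fintype.card (Fin K → α) + K * ((K * M) * Fintype.card (Fin K → α)) := by ring
      omega
    have hfinj : Function.Injective f := by
      by_contra hinj
      exact hf (mem_union_left _ (by simpa using hinj))
    have hfQ : ∀ x ∈ S, ∀ i j, f i ≠ u x j := fun x hx i j hij => by
      refine hf (mem_union_right _ ?_)
      rw [mem_filter_univ]
      exact ⟨i, mem_biUnion.2 ⟨x, hx, mem_image.2 ⟨j, mem_univ _, hij.symm⟩⟩⟩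
    have hne : ∀ x ∈ S, x ≠ a := fun x hx h => ha (h ▸ hx)
    refine ⟨Function.update u a f, fun x hx => ?_, fun x hx y hy hxy => ?_⟩
    · rcases mem_insert.1 hx with rfl | hx
      · rw [Function.update_self]
        exact ⟨hfG, hfinj⟩
      · rw [Function.update_of_ne (hne x hx)]
        exact hu x hx
    · rcases mem_insert.1 hx with hx | hx <;> rcases mem_insert.1 hy with hy | hy
      · exact absurd (hx.trans hy.symm) hxy
      · rw [hx, Function.update_self, Function.update_of_ne (hne y hy)]
        exact hfQ y hy
      · rw [hy, Function.update_self, Function.update_of_ne (hne x hx)]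
        exact fun i j h => hfQ x hx j i h.symm
      · rw [Function.update_of_ne (hne x hx), Function.update_of_ne (hne y hy)]
        exact hdis x hx y hy hxy

end Packing

theorem List.IsCyclicFor.exists_eq_const {τ κ : Type*} {f : τ → τ} {l : List τ}
    (h : l.IsCyclicFor f) (hne : l ≠ []) {c : τ → κ} (hc : ∀ x ∈ l, c (f x) = c x) :
    ∃ c₀, ∀ x ∈ l, c x = c₀ := by
  obtain ⟨x, t, rfl⟩ := List.exists_cons_of_ne_nil hne
  refine ⟨c x, ?_⟩
  have hchain := h.1
  clear h hne
  induction t generalizing x with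
  | nil => simp
  | cons y t ih =>
    rw [List.isChain_cons_cons] at hchain
    have hyx : c y = c x := by rw [← hchain.1, hc x (by simp)]
    intro z hz
    rcases List.mem_cons.1 hz with rfl | hz
    · rfl
    · rw [ih y (fun w hw => hc w (List.mem_cons_of_mem _ hw)) hchain.2 z hz, hyx]

/-- The set `C` can be cyclically ordered so that all sets of `k` consecutive vertices receive the
same colour. -/
def HasMonoCyclicOrder {α β : Type*} [DecidableEq α] (k : ℕ) (χ : Finset α → β)
    (C : Finset α) : Prop :=
  ∃ (g : ℕ → α) (c : β), (∀ i, g (i + #C) = g i) ∧ Set.InjOn g (Set.Iio #C) ∧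
    (range #C).image g = C ∧ ∀ i, χ ((range k).image fun j => g (i + j)) = c

section Assembly

variable {α : Type*} [Fintype α] [DecidableEq α]

theorem card_le_of_pairwise_small_inter {τ β : Type*} [DecidableEq τ] [DecidableEq β] {r : ℕ}
    (c : τ → Fin r)
    (Z : τ → Finset β) (W : Finset β) (hW : W.Nonempty) {D : ℝ} (hD : 0 < D) (I : Finset τ)
    (hZ : ∀ x ∈ I, Z x ⊆ W ∧ D * #W ≤ #(Z x))
    (hI : ∀ x ∈ I, ∀ y ∈ I, c x = c y → D ^ 2 / 2 * #W ≤ #(Z x ∩ Z y) → x = y) :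
    (#I : ℝ) ≤ r * (2 / D) := by
  have hfib : ∀ i : Fin r, (#{x ∈ I | c x = i} : ℝ) ≤ 2 / D := fun i => by
    by_contra! hbig
    obtain ⟨x, hx, y, hy, hxy, hlarge⟩ := exists_large_inter {x ∈ I | c x = i} W hW Z
      (fun x hx => (hZ x (mem_filter.1 hx).1).1) D hD (fun x hx => (hZ x (mem_filter.1 hx).1).2)
      hbig.le
    rw [mem_filter] at hx hy
    exact hxy (hI x hx.1 y hy.1 (hx.2.trans hy.2.symm) hlarge)
  have h1 : #I = ∑ i : Fin r, #{x ∈ I | c x = i} :=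
    card_eq_sum_card_fiberwise fun x _ => mem_univ _
  rw [h1, Nat.cast_sum]
  refine (sum_le_sum fun i _ => hfib i).trans ?_
  simp

/-- A family of disjoint pieces that are linked through a common reservoir `R₀` can be closed up
to few monochromatic tight cycles. -/
theorem exists_cycles_of_packing {r K : ℕ} (χ : Finset α → Fin r) (R₀ : Finset α)
    (hR₀ : R₀.Nonempty) {D : ℝ} (hD : 0 < D) (𝒬 : Finset (Finset α)) (M : ℕ) (hM : #𝒬 ≤ M)
    (h𝒬 : ∀ S ∈ 𝒬, ∃ (c : Fin r) (p : List (Fin (K + 1) → α) × α) (Z : Finset (Fin K → α)),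
      IsPiece χ c Z p ∧ Z ⊆ Fintype.piFinset (fun _ => R₀) ∧ D * (#R₀ : ℝ) ^ K ≤ #Z ∧
        pieceSupp p = S)
    (hdis : (𝒬 : Set (Finset α)).PairwiseDisjoint id)
    (hdisR : ∀ S ∈ 𝒬, Disjoint S R₀)
    (hlink : (K : ℝ) ^ 2 * (M + 1) * (Fintype.card α : ℝ) ^ K <
      D ^ 2 / 2 * (#R₀ : ℝ) ^ K * Fintype.card α) :
    ∃ 𝒞 : Finset (Finset α), (∀ C ∈ 𝒞, HasMonoCyclicOrder (K + 1) χ C) ∧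
      (𝒞 : Set (Finset α)).PairwiseDisjoint id ∧ (#𝒞 : ℝ) ≤ r * (2 / D) ∧
      𝒬.biUnion id ⊆ 𝒞.biUnion id := by
  have : Nonempty α := hR₀.to_subtype.map (↑)
  have : Nonempty (Fin r) := ⟨χ ∅⟩
  choose! c p Z hp hZR hZD hsupp using h𝒬
  set W : Finset (Fin K → α) := Fintype.piFinset fun _ => R₀ with hWdef
  have hWcard : (#W : ℝ) = (#R₀ : ℝ) ^ K := by
    rw [hWdef, Fintype.card_piFinset]
    simp
  have hW : W.Nonempty := by
    rw [hWdef, Fintype.piFinset_nonempty]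
    exact fun _ => hR₀
  have hWpos : (0 : ℝ) < #W := mod_cast hW.card_pos
  rw [← hWcard] at hZD hlink
  obtain ⟨f, 𝓛, I, hf, hnd, h𝓛S, h𝓛, hIS, hIcard, hI⟩ := exists_cyclic_partition
    (R := fun x y => x = y ∨ (c x = c y ∧ D ^ 2 / 2 * #W ≤ #(Z x ∩ Z y))) (fun _ => Or.inl rfl)
    (fun x y h => h.imp Eq.symm fun h => ⟨h.1.symm, by rw [inter_comm]; exact h.2⟩) 𝒬
  have hIle : (#I : ℝ) ≤ r * (2 / D) := card_le_of_pairwise_small_inter c Z W hW hD I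
    (fun x hx => ⟨hZR x (hIS hx), hZD x (hIS hx)⟩)
    fun x hx y hy h1 h2 => hI x hx y hy (Or.inr ⟨h1, h2⟩)
  have hcf : ∀ x ∈ 𝒬, c (f x) = c x := fun x hx => by
    rcases (hf x hx).2 with h | h
    exacts [by rw [← h], h.1.symm]
  have hinter : ∀ x ∈ 𝒬, D ^ 2 / 2 * #W ≤ #(Z x ∩ Z (f x)) := fun x hx => by
    rcases (hf x hx).2 with h | h
    · have hxx : Z x ∩ Z (f x) = Z x := by rw [← h, inter_self]
      rw [hxx]
      have h1 : D * #W ≤ 1 * #W := by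
        rw [one_mul]
        exact (hZD x hx).trans (mod_cast card_le_card (hZR x hx))
      have h2 : D ≤ 1 := le_of_mul_le_mul_right h1 hWpos
      refine (mul_le_mul_of_nonneg_right ?_ hWpos.le).trans (hZD x hx)
      nlinarith
    · exact h.2
  obtain ⟨u, hu, hudis⟩ := exists_disjoint_links 𝒬 (fun x => Z x ∩ Z (f x)) M hM fun x hx => by
    have h1 : D ^ 2 / 2 * #W * Fintype.card α ≤ #(Z x ∩ Z (f x)) * Fintype.card α := by
      gcongr
      exact hinter x hx
    have h2 := hlink.trans_le h1
    rw [Fintype.card_fun, Fintype.card_fin]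
    exact_mod_cast h2
  have huR : ∀ x ∈ 𝒬, ∀ i, u x i ∈ R₀ := fun x hx i =>
    Fintype.mem_piFinset.1 (hZR x hx (mem_inter.1 (hu x hx).1).1) i
  let vtx : Finset α → List α := fun x =>
    ((p x).1.flatMap List.ofFn ++ [(p x).2]) ++ List.ofFn (u x)
  have hvtx : ∀ x ∈ 𝒬, ∀ v, v ∈ vtx x ↔ v ∈ x ∨ ∃ i, u x i = v := fun x hx v => by
    have h1 : v ∈ pieceSupp (p x) ↔ v ∈ x := by rw [hsupp x hx]
    rw [pieceSupp, List.mem_toFinset] at h1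
    rw [List.mem_append, h1, List.mem_ofFn]
  have hvnd : ∀ x ∈ 𝒬, (vtx x).Nodup := fun x hx => by
    rw [List.nodup_append']
    refine ⟨(hp x hx).nodup, List.nodup_ofFn.2 (hu x hx).2, fun v hv hv' => ?_⟩
    obtain ⟨i, rfl⟩ := List.mem_ofFn.1 hv'
    have h1 : u x i ∈ pieceSupp (p x) := List.mem_toFinset.2 hv
    rw [hsupp x hx] at h1
    exact disjoint_left.1 (hdisR x hx) h1 (huR x hx i)
  have hvdis : ∀ x ∈ 𝒬, ∀ y ∈ 𝒬, x ≠ y → List.Disjoint (vtx x) (vtx y) := by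
    intro x hx y hy hxy v hv hv'
    rw [hvtx x hx] at hv
    rw [hvtx y hy] at hv'
    rcases hv with hv | ⟨i, rfl⟩ <;> rcases hv' with hv' | ⟨j, hj⟩
    · exact disjoint_left.1 (hdis hx hy hxy) hv hv'
    · exact disjoint_left.1 (hdisR x hx) hv (hj ▸ huR y hy j)
    · exact disjoint_left.1 (hdisR y hy) hv' (huR x hx i)
    · exact hudis x hx y hy hxy i j hj.symm
  have hmem : ∀ l ∈ 𝓛, ∀ x ∈ l, x ∈ 𝒬 := fun l hl x hx => by
    rw [← h𝓛S, List.mem_toFinset, List.mem_flatten]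
    exact ⟨l, hl, hx⟩
  rw [List.nodup_flatten] at hnd
  let C : List (Finset α) → Finset α := fun l => (l.flatMap vtx).toFinset
  have hCdis : ∀ l ∈ 𝓛, ∀ l' ∈ 𝓛, l ≠ l' → Disjoint (C l) (C l') := by
    intro l hl l' hl' hll
    have : Std.Symm (List.Disjoint (α := Finset α)) := ⟨fun _ _ h => h.symm⟩
    have hdl : List.Disjoint l l' := hnd.2.forall hl hl' hll
    refine disjoint_left.2 fun v hv hv' => ?_
    obtain ⟨x, hx, hvx⟩ := List.mem_flatMap.1 (List.mem_toFinset.1 hv)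
    obtain ⟨y, hy, hvy⟩ := List.mem_flatMap.1 (List.mem_toFinset.1 hv')
    refine hvdis x (hmem l hl x hx) y (hmem l' hl' y hy) ?_ hvx hvy
    rintro rfl
    exact hdl hx hy
  refine ⟨(𝓛.map C).toFinset, ?_, ?_, ?_, ?_⟩
  · intro C' hC'
    obtain ⟨l, hl, rfl⟩ := List.mem_map.1 (List.mem_toFinset.1 hC')
    obtain ⟨hne, hcyc⟩ := h𝓛 l hl
    obtain ⟨c₀, hc₀⟩ := hcyc.exists_eq_const hne fun x hx => hcf x (hmem l hl x hx)
    obtain ⟨hne', hchain, hclose⟩ := hcyc.isChain_flatMap (R := CellRel χ c₀)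
      (fun x => (p x).1) (fun x => (Fin.cons (p x).2 (u x) : Fin (K + 1) → α)) hne
      fun x hx => by
        have hx𝒬 := hmem l hl x hx
        have hfx := (hf x hx𝒬).1
        rw [← hc₀ x hx, ← hcf x hx𝒬]
        exact (hp (f x) hfx).chain (p x).2 (u x) (mem_inter.1 (hu x hx𝒬).1).2 (u (f x))
          (mem_inter.1 (hu (f x) hfx).1).1
    have hflat : (l.flatMap fun x =>
        (p x).1 ++ [(Fin.cons (p x).2 (u x) : Fin (K + 1) → α)]).flatMap List.ofFn =
        l.flatMap vtx := by
      rw [List.flatMap_assoc]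
      congr 1
      funext x
      simp [vtx, List.flatMap_append, List.ofFn_succ]
    obtain ⟨g, hg⟩ := exists_cyclic_ordering hchain hne' hclose (by
      rw [hflat, List.nodup_flatMap]
      refine ⟨fun x hx => hvnd x (hmem l hl x hx), ?_⟩
      refine (hnd.1 l hl).imp_of_mem fun {x y} hx hy hxy => ?_
      exact hvdis x (hmem l hl x hx) y (hmem l hl y hy) hxy) (C l) (by rw [hflat])
    exact ⟨g, c₀, hg⟩
  · intro A hA B hB hAB
    rw [mem_coe] at hA hB
    obtain ⟨l, hl, rfl⟩ := List.mem_map.1 (List.mem_toFinset.1 hA)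
    obtain ⟨l', hl', rfl⟩ := List.mem_map.1 (List.mem_toFinset.1 hB)
    exact hCdis l hl l' hl' fun h => hAB (by rw [h])
  · refine le_trans ?_ hIle
    rw [hIcard]
    exact_mod_cast (List.toFinset_card_le _).trans_eq (List.length_map _)
  · intro v hv
    obtain ⟨x, hx, hvx⟩ := mem_biUnion.1 hv
    have hx' := hx
    rw [← h𝓛S, List.mem_toFinset, List.mem_flatten] at hx'
    obtain ⟨l, hl, hxl⟩ := hx'
    refine mem_biUnion.2 ⟨C l, List.mem_toFinset.2 (List.mem_map.2 ⟨l, hl, rfl⟩), ?_⟩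
    exact List.mem_toFinset.2 (List.mem_flatMap.2 ⟨x, hxl, (hvtx x hx v).2 (Or.inl hvx)⟩)

end Assembly

/-- In a large vertex set there is a labelling with almost equal label classes such that, for all
but few cells, no label class contains many more tuples of the associated set than the class of
the label `0`. -/
theorem exists_equitable_labelling (K q : ℕ) (τ κ : ℝ) (hτ : 0 < τ) (hκ : 0 < κ) : ∃ N₂ : ℕ,
    ∀ (α : Type) [Fintype α] [DecidableEq α], N₂ ≤ Fintype.card α →
    ∀ A : (Fin (K + 1) → α) → Finset (Fin K → α), ∃ h : α → Fin (q + 1), ∀ s,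
      (Fintype.card α : ℝ) / (2 * (q + 1)) ≤ #{v | h v = s} ∧
      (#{v | h v = s} : ℝ) ≤ 2 * Fintype.card α / (q + 1) ∧
      (#{e | τ * (Fintype.card α : ℝ) ^ K < (labelCount h s (A e) : ℝ) - labelCount h 0 (A e)} : ℝ)
        ≤ κ * (Fintype.card α : ℝ) ^ (K + 1) := by
  refine ⟨max (max 1 (32 * (q + 1) ^ 3)) ⌈2 * (q + 1) * (K : ℝ) ^ 2 / (κ * τ ^ 2)⌉₊,
    fun α _ _ hN A => ?_⟩
  rw [max_le_iff, max_le_iff, Nat.ceil_le] at hN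
  obtain ⟨⟨hN1, hNq⟩, hNK⟩ := hN
  have : Nonempty α := Fintype.card_pos_iff.1 hN1
  obtain ⟨h, hh⟩ := exists_balanced_labelling (0 : Fin (q + 1)) A
  set N := (Fintype.card α : ℝ) with hNdef
  have hN0 : 0 < N := by
    rw [hNdef]
    exact_mod_cast hN1
  have hq0 : (0 : ℝ) < q + 1 := by positivity
  have hNq' : 32 * ((q : ℝ) + 1) ^ 3 ≤ N := by
    rw [hNdef]
    exact_mod_cast hNq
  rw [div_le_iff₀ (by positivity)] at hNK
  simp only [Fintype.card_fin, Nat.cast_add, Nat.cast_one, Fintype.card_fun, Nat.cast_pow,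
    ← hNdef] at hh
  set x := N / (4 * (q + 1)) with hx
  have hxN : N = 4 * (q + 1) * x := by
    rw [hx]
    field_simp
  have hx0 : 0 ≤ x := by positivity
  have hdiff : ∀ s, |(#{v | h v = s} : ℝ) - #{v | h v = 0}| ≤ x := fun s => by
    refine abs_le_of_sq_le_sq ((hh s).1.trans ?_) hx0
    have h1 : 8 * ((q : ℝ) + 1) ^ 2 ≤ x := by
      have : 4 * ((q : ℝ) + 1) * (8 * (q + 1) ^ 2) ≤ 4 * (q + 1) * x := by
        rw [← hxN]
        linarith
      exact le_of_mul_le_mul_left this (by positivity)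
    calc 2 * ((q : ℝ) + 1) * N = 8 * (q + 1) ^ 2 * x := by
          rw [hxN]
          ring
      _ ≤ x * x := by gcongr
      _ = x ^ 2 := by ring
  have hsum : ∑ s, (#{v | h v = s} : ℝ) = N := by
    have := card_eq_sum_card_fiberwise (s := (univ : Finset α)) (t := (univ : Finset (Fin (q + 1))))
      (f := h) fun _ _ => mem_univ _
    rw [hNdef, ← card_univ, this]
    push_cast
    rfl
  have hlow : ((q : ℝ) + 1) * (#{v | h v = 0} - x) ≤ N := by
    rw [← hsum]
    have := card_nsmul_le_sum (univ : Finset (Fin (q + 1))) (fun s => (#{v | h v = s} : ℝ))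
      (#{v | h v = 0} - x) fun s _ => by
        have := (abs_le.1 (hdiff s)).1
        linarith
    rw [card_univ, Fintype.card_fin, nsmul_eq_mul] at this
    exact_mod_cast this
  have hup : N ≤ ((q : ℝ) + 1) * (#{v | h v = 0} + x) := by
    rw [← hsum]
    have := sum_le_card_nsmul (univ : Finset (Fin (q + 1))) (fun s => (#{v | h v = s} : ℝ))
      (#{v | h v = 0} + x) fun s _ => by
        have := (abs_le.1 (hdiff s)).2
        linarith
    rw [card_univ, Fintype.card_fin, nsmul_eq_mul] at this
    exact_mod_cast this
  have hlow' : (#{v | h v = 0} : ℝ) ≤ 5 * x := by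
    have : ((q : ℝ) + 1) * (#{v | h v = 0} - x) ≤ (q + 1) * (4 * x) := by
      refine hlow.trans_eq ?_
      rw [hxN]
      ring
    have := le_of_mul_le_mul_left this hq0
    linarith
  have hup' : 3 * x ≤ (#{v | h v = 0} : ℝ) := by
    have : ((q : ℝ) + 1) * (4 * x) ≤ (q + 1) * (#{v | h v = 0} + x) := by
      refine le_trans (le_of_eq ?_) hup
      rw [hxN]
      ring
    have := le_of_mul_le_mul_left this hq0
    linarith
  refine ⟨h, fun s => ⟨?_, ?_, ?_⟩⟩
  · have h1 : N / (2 * (q + 1)) = 2 * x := by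
      rw [hx]
      field_simp
      norm_num
    have := (abs_le.1 (hdiff s)).1
    linarith
  · have h1 : 2 * N / (q + 1) = 8 * x := by
      rw [hx]
      field_simp
      norm_num
    have := (abs_le.1 (hdiff s)).2
    linarith
  · set Bad : Finset (Fin (K + 1) → α) :=
      {e | τ * N ^ K < (labelCount h s (A e) : ℝ) - labelCount h 0 (A e)} with hBad
    have h1 : (#Bad : ℝ) * (τ * N ^ K) ^ 2 ≤
        ∑ e, ((labelCount h s (A e) : ℝ) - labelCount h 0 (A e)) ^ 2 := by
      rw [← nsmul_eq_mul]
      refine (card_nsmul_le_sum Bad _ _ fun e he => ?_).trans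
        (sum_le_sum_of_subset_of_nonneg (subset_univ Bad) fun _ _ _ => sq_nonneg _)
      rw [hBad, mem_filter_univ] at he
      exact pow_le_pow_left₀ (by positivity) he.le 2
    have h2 := (mul_le_mul_of_nonneg_right h1 hN0.le).trans (hh s).2
    have h3 : (#Bad : ℝ) * (τ ^ 2 * N ^ (2 * K) * N) ≤
        κ * N ^ (K + 1) * (τ ^ 2 * N ^ (2 * K) * N) := by
      calc (#Bad : ℝ) * (τ ^ 2 * N ^ (2 * K) * N) = #Bad * (τ * N ^ K) ^ 2 * N := by ring
        _ ≤ 2 * (q + 1) * (N ^ (K + 1) * ((K : ℝ) ^ 2 * N ^ (2 * K))) := h2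
        _ = 2 * (q + 1) * (K : ℝ) ^ 2 * (N ^ (K + 1) * N ^ (2 * K)) := by ring
        _ ≤ N * (κ * τ ^ 2) * (N ^ (K + 1) * N ^ (2 * K)) := by gcongr
        _ = κ * N ^ (K + 1) * (τ ^ 2 * N ^ (2 * K) * N) := by ring
    exact le_of_mul_le_mul_right h3 (by positivity)

/-- Every large edge-coloured complete uniform hypergraph can be almost covered by few disjoint
monochromatic tight cycles. -/
theorem exists_almost_cover (K r : ℕ) (hK : 0 < K) (hr : 0 < r) (ψ : ℝ) (hψ : 0 < ψ) (d : ℝ)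
    (hd : d = 4⁻¹ * ((r : ℝ)⁻¹) ^ 2 ^ K * ((32 * K : ℝ)⁻¹) ^ K) : ∃ N₀ : ℕ,
    ∀ (α : Type) [Fintype α] [DecidableEq α], N₀ ≤ Fintype.card α → ∀ χ : Finset α → Fin r,
    ∃ 𝒞 : Finset (Finset α), (∀ C ∈ 𝒞, HasMonoCyclicOrder (K + 1) χ C) ∧
      (𝒞 : Set (Finset α)).PairwiseDisjoint id ∧ (#𝒞 : ℝ) ≤ 4 * r / d ^ 2 ∧
      (#(univ \ 𝒞.biUnion id) : ℝ) ≤ ψ * Fintype.card α := by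
  have hK' : (0 : ℝ) < K := mod_cast hK
  have hK1 : (1 : ℝ) ≤ K := mod_cast hK
  have hr' : (0 : ℝ) < r := mod_cast hr
  have hd0 : 0 < d := by
    rw [hd]
    positivity
  set q : ℕ := ⌈4 / ψ⌉₊ with hq
  have hqψ : 4 ≤ ψ * (q + 1) := by
    have h1 : 4 / ψ ≤ q := Nat.le_ceil _
    rw [div_le_iff₀ hψ] at h1
    nlinarith
  set θ := (16 * K * (q + 1) : ℝ)⁻¹ with hθ
  have hθ0 : 0 < θ := by positivity
  set c₁ : ℝ := 2⁻¹ * ((r : ℝ)⁻¹) ^ 2 ^ K with hc₁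
  have hc₁0 : 0 < c₁ := by positivity
  set γ := (d ^ 2 / 2) ^ 2 / 2 * ((2 * (q + 1) : ℝ)⁻¹) ^ K with hγ
  have hγ0 : 0 < γ := by positivity
  set m : ℕ := max 3 (max ⌈2 / d⌉₊ ⌈2 * K ^ 2 / γ⌉₊) with hm
  have hm3 : 3 ≤ m := le_max_left _ _
  have hmd : 2 / d ≤ m := Nat.ceil_le.1 ((le_max_left _ _).trans (le_max_right _ _))
  have hmγ : 2 * K ^ 2 / γ ≤ m := Nat.ceil_le.1 ((le_max_right _ _).trans (le_max_right _ _))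
  obtain ⟨N₁, hN₁⟩ := exists_piece m K r hm3 hr d θ c₁ hd0 hmd hθ0 hc₁
  obtain ⟨N₂, hN₂⟩ := exists_equitable_labelling K q (2⁻¹ * (c₁ * θ ^ K))
    (θ * (c₁ * θ ^ K) / 2) (by positivity) (by positivity)
  refine ⟨max (max N₁ N₂) (max (4 * (q + 1) * K) (⌈2 * K ^ 2 / γ⌉₊ + 1)),
    fun α _ _ hN χ => ?_⟩
  simp only [max_le_iff] at hN
  obtain ⟨⟨hNN₁, hNN₂⟩, hNq, hNγ⟩ := hN
  obtain ⟨h, hh⟩ := hN₂ α hNN₂ fun e => mixNbr (edgeCol χ (e 0)) (fun j => e j.succ)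
  have hpieces := hN₁ α hNN₁ χ
  set N := (Fintype.card α : ℝ) with hNdef
  have hN0 : 0 < N := by
    rw [hNdef]
    exact_mod_cast Nat.pos_of_ne_zero (by omega)
  have hNq' : 4 * ((q : ℝ) + 1) * K ≤ N := by
    rw [hNdef]
    exact_mod_cast hNq
  have hNγ' : 2 * K ^ 2 / γ < N := by
    rw [hNdef]
    exact Nat.lt_of_ceil_lt (by omega)
  set R₀ : Finset α := {v | h v = 0} with hR₀
  have hR₀low : N * (2 * (q + 1) : ℝ)⁻¹ ≤ #R₀ := (hh 0).1
  have hR₀up : (#R₀ : ℝ) ≤ 2 * N / (q + 1) := (hh 0).2.1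
  have hR₀pos : (0 : ℝ) < #R₀ := lt_of_lt_of_le (by positivity) hR₀low
  have hR₀ne : R₀.Nonempty := card_pos.1 (mod_cast hR₀pos)
  have hdR : d * (#R₀ : ℝ) ^ K ≤ 2⁻¹ * (c₁ * θ ^ K) * N ^ K := by
    have h1 : (32 * K : ℝ)⁻¹ * #R₀ ≤ θ * N := by
      calc (32 * K : ℝ)⁻¹ * #R₀ ≤ (32 * K : ℝ)⁻¹ * (2 * N / (q + 1)) := by gcongr
        _ = θ * N := by
          rw [hθ]
          field_simp
          norm_num
    calc d * (#R₀ : ℝ) ^ K = 2⁻¹ * c₁ * ((32 * K : ℝ)⁻¹ * #R₀) ^ K := by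
          rw [hd, hc₁, mul_pow]
          ring
      _ ≤ 2⁻¹ * c₁ * (θ * N) ^ K := by gcongr
      _ = 2⁻¹ * (c₁ * θ ^ K) * N ^ K := by
        rw [mul_pow]
        ring
  have hlabel : ∀ (s : Fin (q + 1)) (A : Finset (Fin K → α)),
      #(A ∩ Fintype.piFinset fun _ => ({v | h v = s} : Finset α)) = labelCount h s A :=
    fun s A => by
      unfold labelCount
      congr 1
      ext u
      simp [Fintype.mem_piFinset]
  have hTdef : 16 * (q + 1) * (K * (θ * N)) = N := by
    rw [hθ]
    field_simp
  have hTle : θ * N ≤ K * (θ * N) := le_mul_of_one_le_left (by positivity) hK1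
  obtain ⟨𝒬, hP, hdis, hU, hleft⟩ := exists_packing_of_labelling (K := K) (T := θ * N)
    (P := fun S => (∃ (c : Fin r) (p : List (Fin (K + 1) → α) × α) (Z : Finset (Fin K → α)),
      IsPiece χ c Z p ∧ Z ⊆ Fintype.piFinset (fun _ => R₀) ∧ d ^ 2 / 2 * (#R₀ : ℝ) ^ K ≤ #Z ∧
        pieceSupp p = S) ∧ m ≤ #S)
    (by positivity) h 0 (by
      intro s _ X Y hXY hYR hX hY
      obtain ⟨c, p, Z, h1, h2, h3, h4, h5, h6⟩ := hpieces {v | h v = s} R₀ _ hR₀ne hdR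
        (hh s).2.2 (fun e he => by
          rw [mem_filter_univ, not_lt] at he
          rw [hlabel, hlabel]
          linarith) X Y hXY hYR hX hY
      exact ⟨pieceSupp p, ⟨⟨c, p, Z, h1, h2, h3, rfl⟩,
        h6.trans (card_le_card inter_subset_left)⟩, h4, h5, by omega⟩)
    (by
      intro s _
      refine le_trans ?_ (hh s).1
      rw [le_div_iff₀ (by positivity)]
      have h1 : (K * (3 * (θ * N) + 1) + θ * N) * (2 * (q + 1)) ≤
          (4 * (K * (θ * N)) + K) * (2 * (q + 1)) :=
        mul_le_mul_of_nonneg_right (by linarith) (by positivity)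
      linarith)
  have hm𝒬 : #𝒬 * m ≤ Fintype.card α := by
    calc #𝒬 * m ≤ ∑ S ∈ 𝒬, #S := by
          rw [← smul_eq_mul]
          exact card_nsmul_le_sum _ _ _ fun S hS => (hP S hS).2
      _ = #(𝒬.biUnion id) := (card_biUnion fun S hS S' hS' hne => hdis hS hS' hne).symm
      _ ≤ Fintype.card α := card_le_univ _
  have hm𝒬' : (#𝒬 : ℝ) * m ≤ N := by
    rw [hNdef]
    exact_mod_cast hm𝒬
  obtain ⟨𝒞, h𝒞, h𝒞dis, h𝒞card, h𝒞sub⟩ := exists_cycles_of_packing χ R₀ hR₀ne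
    (D := d ^ 2 / 2) (by positivity) 𝒬 #𝒬 le_rfl (fun S hS => (hP S hS).1) hdis
    (fun S hS => disjoint_left.2 fun v hv hv' => by
      rw [hR₀, mem_filter_univ] at hv'
      exact hU v (mem_biUnion.2 ⟨S, hS, hv⟩) hv')
    (by
      have h1 : γ * N ^ K ≤ (d ^ 2 / 2) ^ 2 / 2 * (#R₀ : ℝ) ^ K := by
        calc γ * N ^ K = (d ^ 2 / 2) ^ 2 / 2 * (N * (2 * (q + 1) : ℝ)⁻¹) ^ K := by
              rw [hγ, mul_pow]
              ring
          _ ≤ _ := by gcongr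
      rw [div_lt_iff₀ hγ0] at hNγ'
      rw [div_le_iff₀ hγ0] at hmγ
      have h2 : (#𝒬 : ℝ) * (2 * K ^ 2) ≤ N * γ := by
        calc (#𝒬 : ℝ) * (2 * K ^ 2) ≤ #𝒬 * (m * γ) := by gcongr
          _ = #𝒬 * m * γ := by ring
          _ ≤ N * γ := by gcongr
      calc (K : ℝ) ^ 2 * (#𝒬 + 1) * N ^ K < γ * N * N ^ K := by
            exact mul_lt_mul_of_pos_right (by linarith) (by positivity)
        _ = γ * N ^ K * N := by ring
        _ ≤ _ := by gcongr)
  refine ⟨𝒞, h𝒞, h𝒞dis, h𝒞card.trans_eq ?_, ?_⟩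
  · field_simp
    norm_num
  · have hsub : univ \ 𝒞.biUnion id ⊆ R₀ ∪ ({v | h v ≠ 0} : Finset α) \ 𝒬.biUnion id := by
      intro v hv
      rw [mem_sdiff] at hv
      by_cases hv0 : h v = 0
      · exact mem_union_left _ (by simpa [hR₀] using hv0)
      · refine mem_union_right _ (mem_sdiff.2 ⟨by simpa using hv0, fun hv' => hv.2 (h𝒞sub hv')⟩)
    have h1 : (#(univ \ 𝒞.biUnion id) : ℝ) ≤
        #R₀ + #(({v | h v ≠ 0} : Finset α) \ 𝒬.biUnion id) := by
      exact_mod_cast (card_le_card hsub).trans (card_union_le _ _)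
    have h2 : (#(univ \ 𝒞.biUnion id) : ℝ) ≤ 4 * N / (q + 1) := by
      have h3 : 3 * (θ * N) + 1 ≤ 2 * N / (q + 1) := by
        rw [le_div_iff₀ (by positivity)]
        have h4 : (q + 1) * (θ * N) ≤ (q + 1) * (K * (θ * N)) := by gcongr
        have h5 : ((q : ℝ) + 1) * 1 ≤ (q + 1) * K := by gcongr
        linarith
      have h6 : 4 * N / (q + 1) = 2 * N / (q + 1) + 2 * N / (q + 1) := by ring
      linarith
    refine h2.trans ?_
    rw [div_le_iff₀ (by positivity)]
    nlinarith

theorem cycle_count_bound {K r : ℕ} (hK : 0 < K) (hr : 0 < r) :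
    (4 * r / (4⁻¹ * ((r : ℝ)⁻¹) ^ 2 ^ K * ((32 * K : ℝ)⁻¹) ^ K) ^ 2 : ℝ) ≤
      2 ^ 18 * r * (2 * r) ^ (5 * 2 ^ (K + 1 + 1)) := by
  have hr' : (1 : ℝ) ≤ r := by exact_mod_cast hr
  have hK' : (0 : ℝ) < K := by exact_mod_cast hK
  have h1 : (4 * r / (4⁻¹ * ((r : ℝ)⁻¹) ^ 2 ^ K * ((32 * K : ℝ)⁻¹) ^ K) ^ 2 : ℝ) =
      2 ^ 6 * r * ((32 * K : ℝ) ^ (2 * K) * (r : ℝ) ^ (2 * 2 ^ K)) := by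
    rw [inv_pow, inv_pow, mul_pow, mul_pow, inv_pow, inv_pow, inv_pow, ← pow_mul, ← pow_mul]
    field_simp
    ring
  have hsq : 2 * K ≤ 2 ^ K ∧ K * K + 1 ≤ 2 * 2 ^ K := by
    clear hK hK' h1
    induction K with
    | zero => norm_num
    | succ n ih =>
      rw [pow_succ]
      have : n < 2 ^ n := Nat.lt_two_pow_self
      constructor <;> nlinarith
  have h2 : (32 * K : ℝ) ^ (2 * K) ≤ 2 ^ 12 * 2 ^ (20 * 2 ^ K) := by
    have : (32 * K : ℝ) ≤ 2 ^ (K + 4) := by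
      have : (2 * K : ℝ) ≤ 2 ^ K := by exact_mod_cast hsq.1
      rw [pow_add]
      linarith
    calc (32 * K : ℝ) ^ (2 * K) ≤ (2 ^ (K + 4)) ^ (2 * K) := by gcongr
      _ = 2 ^ ((K + 4) * (2 * K)) := (pow_mul _ _ _).symm
      _ ≤ 2 ^ (12 + 20 * 2 ^ K) := by
        gcongr
        · norm_num
        · nlinarith [hsq]
      _ = _ := pow_add _ _ _
  have h3 : (r : ℝ) ^ (2 * 2 ^ K) ≤ r ^ (20 * 2 ^ K) := by
    gcongr
    norm_num
  have h4 : 5 * 2 ^ (K + 1 + 1) = 20 * 2 ^ K := by ring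
  rw [h1, h4, mul_pow 2 (r : ℝ)]
  calc (2 : ℝ) ^ 6 * r * ((32 * K : ℝ) ^ (2 * K) * (r : ℝ) ^ (2 * 2 ^ K))
      ≤ 2 ^ 6 * r * (2 ^ 12 * 2 ^ (20 * 2 ^ K) * r ^ (20 * 2 ^ K)) := by gcongr
    _ = _ := by ring

theorem HasMonoCyclicOrder.map {α γ β : Type*} [DecidableEq α] [DecidableEq γ] {k : ℕ}
    {χ : Finset γ → β} {C : Finset α} (e : α ↪ γ)
    (h : HasMonoCyclicOrder k (fun S => χ (S.map e)) C) : HasMonoCyclicOrder k χ (C.map e) := by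
  obtain ⟨g, c, hper, hinj, himg, hc⟩ := h
  refine ⟨fun i => e (g i), c, fun i => ?_, ?_, ?_, fun i => ?_⟩
  · simp only [card_map, hper]
  · rw [card_map]
    exact e.injective.comp_injOn hinj
  · rw [card_map]
    nth_rw 2 [← himg]
    rw [map_eq_image, image_image]
    rfl
  · simp only [← hc i, map_eq_image, image_image]
    rfl

/-- Every large vertex set can be covered, up to few vertices, by boundedly many disjoint
monochromatic tight cycles. -/
theorem exists_almost_cover_of_subset {K r : ℕ} (hK : 0 < K) (hr : 0 < r) {ψ : ℝ} (hψ : 0 < ψ) :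
    ∃ N₀ : ℕ, ∀ (α : Type) [DecidableEq α] (χ : Finset α → Fin r) (B : Finset α), N₀ ≤ #B →
      ∃ 𝒞 : Finset (Finset α), (∀ C ∈ 𝒞, HasMonoCyclicOrder (K + 1) χ C) ∧
        (𝒞 : Set (Finset α)).PairwiseDisjoint id ∧ 𝒞.biUnion id ⊆ B ∧
        #𝒞 ≤ 2 ^ 18 * r * (2 * r) ^ (5 * 2 ^ (K + 1 + 1)) ∧
        (#(B \ 𝒞.biUnion id) : ℝ) ≤ ψ * #B := by
  obtain ⟨N₀, h⟩ := exists_almost_cover K r hK hr ψ hψ _ rfl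
  refine ⟨N₀, fun α _ χ B hB => ?_⟩
  let e : B ↪ α := Function.Embedding.subtype _
  obtain ⟨𝒞, h𝒞, hdis, hcard, hleft⟩ := h B (by simpa using hB) (fun S => χ (S.map e))
  have hU : (𝒞.map (mapEmbedding e).toEmbedding).biUnion id = (𝒞.biUnion id).map e := by
    ext v
    simp only [mem_biUnion, mem_map, RelEmbedding.coe_toEmbedding, mapEmbedding_apply, id]
    constructor
    · rintro ⟨_, ⟨C, hC, rfl⟩, hv⟩
      obtain ⟨w, hw, rfl⟩ := mem_map.1 hv
      exact ⟨w, ⟨C, hC, hw⟩, rfl⟩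
    · rintro ⟨w, ⟨C, hC, hw⟩, rfl⟩
      exact ⟨_, ⟨C, hC, rfl⟩, mem_map_of_mem _ hw⟩
  have hB' : B = univ.map e := by
    rw [univ_eq_attach]
    exact (attach_map_val).symm
  refine ⟨𝒞.map (mapEmbedding e).toEmbedding, ?_, ?_, ?_, ?_, ?_⟩
  · intro C hC
    obtain ⟨C', hC', rfl⟩ := mem_map.1 hC
    exact (h𝒞 C' hC').map e
  · rw [coe_map]
    rintro _ ⟨C, hC, rfl⟩ _ ⟨C', hC', rfl⟩ hne
    exact (disjoint_map e).2 (hdis hC hC' fun h => hne (h ▸ rfl))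
  · rw [hU]
    exact (map_subset_map.2 (subset_univ _)).trans_eq hB'.symm
  · rw [card_map]
    exact_mod_cast hcard.trans (cycle_count_bound hK hr)
  · rw [hU]
    have hsub : B \ (𝒞.biUnion id).map e = (univ \ 𝒞.biUnion id).map e := by
      rw [Finset.map_sdiff, ← hB']
    rw [hsub, card_map]
    simpa using hleft

theorem le_ceil_mul {a : ℝ} (ha : 0 < a) (N n : ℕ) (hn : ⌈N / a⌉₊ ≤ n) : N ≤ ⌈a * n⌉₊ := by
  have h : (N : ℝ) ≤ a * n := by
    rw [mul_comm, ← div_le_iff₀ ha]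
    exact Nat.ceil_le.1 hn
  exact_mod_cast h.trans (Nat.le_ceil _)

end AlmostCover

theorem larger_absorption (k r : ℕ) (hk : 3 ≤ k) :
    ∃ ψ₀ : ℝ, 0 < ψ₀ ∧ ∀ ψ : ℝ, 0 < ψ → ψ ≤ ψ₀ →
      ∃ n₀ : ℕ, ∀ n : ℕ, n₀ ≤ n → ∀ χ : Finset (Fin n) → Fin r,
        ∃ U : Finset (Fin n), (U.card : ℝ) ≤ 3 * n / 4 ∧
          ∀ B : Finset (Fin n), Disjoint B U →
            B.card = ⌈4 * (((2 * r : ℝ) ^ (2 ^ (k + 7)))⁻¹ / k) * n⌉₊ →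
            ∃ 𝒞 : Finset (Finset (Fin n)),
              (∀ C ∈ 𝒞, MonoTightCycle k χ C) ∧
              (𝒞 : Set (Finset (Fin n))).PairwiseDisjoint id ∧
              𝒞.biUnion id ⊆ B ∪ U ∧
              𝒞.card ≤ 2 ^ 18 * r * (2 * r) ^ (5 * 2 ^ (k + 1)) + 1 ∧
              (((B ∪ U) \ 𝒞.biUnion id).card : ℝ) ≤ ψ * n := by
  refine ⟨1, one_pos, fun ψ hψ _ => ?_⟩
  obtain rfl | hr := Nat.eq_zero_or_pos r
  · exact ⟨0, fun n _ χ => (χ ∅).elim0⟩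
  obtain ⟨K, rfl⟩ : ∃ K, k = K + 1 := ⟨k - 1, by omega⟩
  obtain ⟨N₀, h⟩ := exists_almost_cover_of_subset (K := K) (by omega) hr hψ
  have hr' : (0 : ℝ) < r := by exact_mod_cast hr
  refine ⟨⌈N₀ / (4 * (((2 * r : ℝ) ^ (2 ^ (K + 1 + 7)))⁻¹ / (K + 1 : ℕ)))⌉₊, fun n hn χ =>
    ⟨∅, by rw [Finset.card_empty, Nat.cast_zero]; positivity, fun B _ hB => ?_⟩⟩
  obtain ⟨𝒞, h𝒞, hdis, hsub, hcard, hleft⟩ :=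
    h (Fin n) χ B (hB ▸ le_ceil_mul (by positivity) N₀ n hn)
  rw [Finset.union_empty]
  refine ⟨𝒞, fun C hC => Or.inr (h𝒞 C hC), hdis, hsub, hcard.trans (Nat.le_succ _),
    hleft.trans ?_⟩
  gcongr
  exact (Finset.card_le_univ B).trans_eq (Fintype.card_fin n)
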